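/- arXiv:1101.1993 — 3 statements merged into one kernel-verified Lean document; each statement's English description precedes it below -/
import Mathlib

section
/- There exists a metric space X that is uniformly discrete (there is c > 0 with d(x,y) ≥ c for all distinct x, y in X), has bounded geometry (for every r > 0 there is N(r) ∈ ℕ such that every closed ball of radius r in X contains at most N(r) points), coarsely embeds into a Hilbert space, and does not have Property A. -/
section CoarseGeometry

/-- `f` is a coarse embedding of `(X, d)` into the normed space `H`:
for all sequences `(x_n)`, `(y_n)` in `X`, `d(x_n, y_n) → ∞` if and only if
`‖f(x_n) - f(y_n)‖ → ∞`. -/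
def IsCoarseEmbedding {X H : Type} [NormedAddCommGroup H] (d : X → X → ℝ) (f : X → H) :
    Prop :=
  ∀ x y : ℕ → X,
    Filter.Tendsto (fun n => d (x n) (y n)) Filter.atTop Filter.atTop ↔
    Filter.Tendsto (fun n => ‖f (x n) - f (y n)‖) Filter.atTop Filter.atTop

/-- `(X, d)` coarsely embeds into a (real) Hilbert space. -/
def CoarselyEmbeddableIntoHilbert {X : Type} (d : X → X → ℝ) : Prop :=
  ∃ (H : Type) (_ : NormedAddCommGroup H) (_ : InnerProductSpace ℝ H)
    (_ : CompleteSpace H) (f : X → H), IsCoarseEmbedding d f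

/-- Property A for a space `X` with distance function `d`: for every `ε > 0` and
`R > 0` there are a family `(A_x)_{x ∈ X}` of finite nonempty subsets of `X × ℕ` and
`S > 0` such that `|A_x △ A_y| < ε · |A_x ∩ A_y|` whenever `d(x,y) ≤ R`, and
`A_x ⊆ B(x, S) × ℕ` for every `x`. -/
def HasPropertyA {X : Type} (d : X → X → ℝ) : Prop :=
  letI : DecidableEq (X × ℕ) := Classical.decEq _
  ∀ ε : ℝ, 0 < ε → ∀ R : ℝ, 0 < R →
    ∃ (A : X → Finset (X × ℕ)) (S : ℝ), 0 < S ∧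
      (∀ x : X, (A x).Nonempty) ∧
      (∀ x y : X, d x y ≤ R →
        ((symmDiff (A x) (A y)).card : ℝ) < ε * ((A x ∩ A y).card : ℝ)) ∧
      (∀ x : X, ∀ p ∈ A x, d x p.1 ≤ S)

end CoarseGeometry


section Construction

/-- A finite set with three involutions such that nontrivial reduced words of
length at most `n` act without fixed points. -/
structure Gph (n : ℕ) where
  V : Type
  fin : Fintype V
  dec : DecidableEq V
  base : V
  s : Fin 3 → V → V
  inv : ∀ i v, s i (s i v) = v
  free : ∀ w : List (Fin 3), w ≠ [] → w.IsChain (· ≠ ·) → w.length ≤ n + 1 →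
    ∀ v, w.foldr s v ≠ v

attribute [instance] Gph.fin Gph.dec

def RBall (n : ℕ) : Type := {l : List (Fin 3) // l.IsChain (· ≠ ·) ∧ l.length ≤ n + 1}

instance (n : ℕ) : Finite (RBall n) := by
  have h := List.finite_length_le (Fin 3) (n + 1)
  exact (h.subset (fun l (hl : l.IsChain (· ≠ ·) ∧ l.length ≤ n + 1) => hl.2)).to_subtype

def stepList (n : ℕ) (i : Fin 3) (l : List (Fin 3)) : List (Fin 3) :=
  if l.head? = some i then l.tail else if l.length < n + 1 then i :: l else l

def stepBall (n : ℕ) (i : Fin 3) (l : RBall n) : RBall n :=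
  ⟨stepList n i l.1, by
    obtain ⟨l, h1, h2⟩ := l
    unfold stepList
    dsimp only
    split_ifs with h h'
    · exact ⟨h1.tail, by simp; omega⟩
    · refine ⟨?_, by simp; omega⟩
      cases l with
      | nil => simp
      | cons a t =>
        simp only [List.head?_cons, Option.some.injEq] at h
        exact List.isChain_cons_cons.2 ⟨fun e => h e.symm, h1⟩
    · exact ⟨h1, h2⟩⟩

theorem stepBall_inv (n : ℕ) (i : Fin 3) : Function.Involutive (stepBall n i) := by
  rintro ⟨l, h1, h2⟩
  apply Subtype.ext
  change stepList n i (stepList n i l) = l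
  cases l with
  | nil => simp [stepList]
  | cons a t =>
    by_cases ha : a = i
    · subst ha
      cases t with
      | nil => simp [stepList]
      | cons b u =>
        have := (List.isChain_cons_cons.1 h1).1
        simp only [List.length_cons] at h2
        simp [stepList, Ne.symm this]
        omega
    · by_cases hl : (a :: t).length < n + 1
      · simp only [List.length_cons] at hl
        simp [stepList, ha, hl]
      · simp only [List.length_cons] at hl
        simp [stepList, ha, hl]

theorem stepBall_foldr (n : ℕ) (w : List (Fin 3)) (hw : w.IsChain (· ≠ ·))
    (hl : w.length ≤ n + 1) :
    ((w.map (fun i => (stepBall_inv n i).toPerm)).prod ⟨[], by simp⟩).1 = w := by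
  induction w with
  | nil => rfl
  | cons a t ih =>
    simp only [List.length_cons] at hl
    have := ih hw.tail (by omega)
    simp only [List.map_cons, List.prod_cons, Equiv.Perm.mul_apply]
    change stepList n a _ = _
    rw [this]
    cases t with
    | nil => simp [stepList]
    | cons b u =>
      have h := (List.isChain_cons_cons.1 hw).1
      simp only [List.length_cons] at hl
      simp [stepList, Ne.symm h]
      omega

noncomputable def gph (n : ℕ) : Gph n where
  V := Equiv.Perm (RBall n)
  fin := Fintype.ofFinite _
  dec := Classical.decEq _
  base := 1
  s i v := (stepBall_inv n i).toPerm * v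
  inv i v := by
    ext x
    simp [Equiv.Perm.mul_apply, (stepBall_inv n i) _]
  free w h0 h1 h2 v h := by
    have key : ∀ w : List (Fin 3), w.foldr (fun i v => (stepBall_inv n i).toPerm * v) v =
        (w.map (fun i => (stepBall_inv n i).toPerm)).prod * v := by
      intro w
      induction w with
      | nil => simp
      | cons a t ih => simp [ih, mul_assoc]
    have h3 := stepBall_foldr n w h1 h2
    rw [key w] at h
    rw [mul_eq_right.1 h] at h3
    exact h0 h3.symm

variable {n : ℕ} (G : Gph n)

/-- Many flags lemma: a flag set with at most one leaf is large. -/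
theorem Gph.many_flags (D : Finset (Fin 3 × G.V))
    (hinv : ∀ i v, (i, v) ∈ D → (i, G.s i v) ∈ D) (y : G.V) (i0 : Fin 3)
    (h0 : (i0, y) ∈ D) (hD : ∀ i v, (i, v) ∈ D → v ≠ y → ∃ j, j ≠ i ∧ (j, v) ∈ D) :
    n < D.card := by
  have key : ∀ k ≤ n, ∃ (i : Fin 3) (u : List (Fin 3)) (T : Finset (Fin 3 × G.V)),
      u.length = k ∧ (i :: u).IsChain (· ≠ ·) ∧ (i, u.foldr G.s y) ∈ D ∧ T ⊆ D ∧
      T.card = k + 1 ∧ ∀ f ∈ T, ∃ t ur, u = t ++ ur ∧ f.2 = ur.foldr G.s y := by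
    intro k
    induction k with
    | zero =>
      intro _
      refine ⟨i0, [], {(i0, y)}, rfl, by simp, by simpa using h0, by simpa using h0, by simp, ?_⟩
      intro f hf
      refine ⟨[], [], rfl, ?_⟩
      simp only [Finset.mem_singleton] at hf
      simp [hf]
    | succ k ih =>
      intro hk
      obtain ⟨i, u, T, hu, hc, hm, hT, hcard, hf⟩ := ih (by omega)
      have hm' : (i, (i :: u).foldr G.s y) ∈ D := hinv _ _ hm
      have hne : (i :: u).foldr G.s y ≠ y :=
        G.free (i :: u) (by simp) hc (by simp; omega) y
      obtain ⟨j, hji, hj⟩ := hD _ _ hm' hne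
      have hnew : (j, (i :: u).foldr G.s y) ∉ T := by
        intro hin
        obtain ⟨t, ur, rfl, hfu⟩ := hf _ hin
        simp only at hfu
        have e : (i :: (t ++ ur)) = (i :: t) ++ ur := rfl
        rw [e, List.foldr_append] at hfu
        rw [e] at hc
        refine G.free (i :: t) (by simp) hc.left_of_append ?_ _ hfu
        simp only [List.length_append, List.length_cons] at hu ⊢
        omega
      refine ⟨j, i :: u, insert (j, (i :: u).foldr G.s y) T, by simp [hu],
        List.isChain_cons_cons.2 ⟨hji, hc⟩, hj, ?_, ?_, ?_⟩
      · exact Finset.insert_subset hj hT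
      · rw [Finset.card_insert_of_notMem hnew, hcard]
      · intro f hfm
        rcases Finset.mem_insert.1 hfm with rfl | hfm
        · exact ⟨[], i :: u, rfl, rfl⟩
        · obtain ⟨t, ur, rfl, h⟩ := hf f hfm
          exact ⟨i :: t, ur, rfl, h⟩
  obtain ⟨i, u, T, -, -, -, hT, hcard, -⟩ := key n le_rfl
  have := Finset.card_le_card hT
  omega

/-- The parity of the number of flags at a vertex. -/
def Gph.par (D : Finset (Fin 3 × G.V)) (v : G.V) : ZMod 2 :=
  ∑ i, if (i, v) ∈ D then 1 else 0

theorem Gph.par_symmDiff (D E : Finset (Fin 3 × G.V)) (v : G.V) :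
    G.par (symmDiff D E) v = G.par D v + G.par E v := by
  unfold Gph.par
  rw [← Finset.sum_add_distrib]
  refine Finset.sum_congr rfl fun i _ => ?_
  by_cases h1 : (i, v) ∈ D <;> by_cases h2 : (i, v) ∈ E <;>
    simp [Finset.mem_symmDiff, h1, h2] <;> decide

theorem Gph.exists_other (D : Finset (Fin 3 × G.V)) (v : G.V) (h : G.par D v = 0)
    (i : Fin 3) (hi : (i, v) ∈ D) : ∃ j, j ≠ i ∧ (j, v) ∈ D := by
  by_contra hcon
  push Not at hcon
  unfold Gph.par at h
  rw [Finset.sum_eq_single i] at h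
  · simp [hi] at h
  · intro j _ hj
    simp [hcon j hj]
  · simp

theorem Gph.exists_of_par (D : Finset (Fin 3 × G.V)) (v : G.V) (h : G.par D v ≠ 0) :
    ∃ i, (i, v) ∈ D := by
  by_contra hcon
  push Not at hcon
  exact h (by simp [Gph.par, hcon])

/-- indicator mod 2 -/
def Gph.del (a v : G.V) : ZMod 2 := if v = a then 1 else 0

theorem zmod2_add_self (a : ZMod 2) : a + a = 0 := by
  revert a; decide

/-- The pieces of our space. -/
structure Gph.Y where
  c : Finset (Fin 3 × G.V)
  p : G.V
  cinv : ∀ i v, (i, v) ∈ c → (i, G.s i v) ∈ c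
  hp : ∀ v, G.par c v = G.del G.base v + G.del p v

theorem Gph.cinv_iff {G : Gph n} (x : G.Y) (i v) : (i, G.s i v) ∈ x.c ↔ (i, v) ∈ x.c :=
  ⟨fun h => by simpa [G.inv] using x.cinv _ _ h, x.cinv i v⟩

theorem Gph.Y.ext_c {G : Gph n} {x z : G.Y} (h : x.c = z.c) : x = z := by
  have hp : x.p = z.p := by
    have h1 := x.hp x.p
    have h2 := z.hp x.p
    rw [h] at h1
    rw [h1] at h2
    have h3 := add_left_cancel h2
    by_contra hne
    simp [Gph.del, hne] at h3
  cases x; cases z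
  simp only at h hp
  subst h; subst hp; rfl

instance (G : Gph n) : Finite G.Y :=
  Finite.of_injective (fun x : G.Y => x.c) (fun _ _ h => Gph.Y.ext_c h)

theorem Gph.par_diff {G : Gph n} (x z : G.Y) (v : G.V) :
    G.par (symmDiff x.c z.c) v = G.del x.p v + G.del z.p v := by
  rw [G.par_symmDiff, x.hp, z.hp]
  have := zmod2_add_self (G.del G.base v)
  linear_combination this

theorem Gph.diff_inv {G : Gph n} (x z : G.Y) (i : Fin 3) (v : G.V)
    (h : (i, v) ∈ symmDiff x.c z.c) : (i, G.s i v) ∈ symmDiff x.c z.c := by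
  simpa only [Finset.mem_symmDiff, Gph.cinv_iff] using h

/-- At most one flag at `x.p`. -/
theorem Gph.unique_flag {G : Gph n} (x z : G.Y) (hcard : (symmDiff x.c z.c).card ≤ n)
    (i j : Fin 3) (hi : (i, x.p) ∈ symmDiff x.c z.c) (hj : (j, x.p) ∈ symmDiff x.c z.c) :
    i = j := by
  by_contra hij
  have hx : ∀ k, ∃ l, l ≠ k ∧ (l, x.p) ∈ symmDiff x.c z.c := by
    intro k
    by_cases hk : i = k
    · exact ⟨j, fun e => hij (hk.trans e.symm), hj⟩
    · exact ⟨i, hk, hi⟩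
  by_cases hz : ∃ k, (k, z.p) ∈ symmDiff x.c z.c
  · obtain ⟨k, hk⟩ := hz
    refine absurd (G.many_flags _ (Gph.diff_inv x z) z.p k hk ?_) (by omega)
    intro l v hl hv
    by_cases hvx : v = x.p
    · subst hvx; exact hx l
    · refine G.exists_other _ v ?_ l hl
      rw [Gph.par_diff]
      simp [Gph.del, hv, hvx]
  · push Not at hz
    refine absurd (G.many_flags _ (Gph.diff_inv x z) x.p i hi ?_) (by omega)
    intro l v hl hvx
    by_cases hv : v = z.p
    · subst hv; exact absurd hl (hz l)
    · refine G.exists_other _ v ?_ l hl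
      rw [Gph.par_diff]
      simp [Gph.del, hv, hvx]

theorem Gph.exists_flag {G : Gph n} (x z : G.Y) (hcard : (symmDiff x.c z.c).card ≤ n)
    (hne : x ≠ z) : ∃ i, (i, x.p) ∈ symmDiff x.c z.c := by
  by_contra hcon
  have hpar : G.par (symmDiff x.c z.c) x.p = 0 := by
    by_contra h
    exact hcon (G.exists_of_par _ _ h)
  have hpz : x.p = z.p := by
    by_contra h
    rw [Gph.par_diff] at hpar
    simp [Gph.del, h] at hpar
  have hD : (symmDiff x.c z.c).Nonempty := by
    rw [Finset.nonempty_iff_ne_empty]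
    intro h
    exact hne (Gph.Y.ext_c (symmDiff_eq_bot.1 h))
  obtain ⟨⟨k, v⟩, hk⟩ := hD
  refine absurd (G.many_flags _ (Gph.diff_inv x z) v k hk ?_) (by omega)
  intro l u hl _
  refine G.exists_other _ u ?_ l hl
  rw [Gph.par_diff, hpz]
  exact zmod2_add_self _

theorem Gph.s_ne (i : Fin 3) (v : G.V) : G.s i v ≠ v :=
  G.free [i] (by simp) (by simp) (by simp) v

/-- The two flags of an edge. -/
def Gph.edge (i : Fin 3) (v : G.V) : Finset (Fin 3 × G.V) := {(i, v), (i, G.s i v)}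

theorem Gph.mem_edge (i j : Fin 3) (v u : G.V) :
    (j, u) ∈ G.edge i v ↔ j = i ∧ (u = v ∨ u = G.s i v) := by
  simp only [Gph.edge, Finset.mem_insert, Finset.mem_singleton, Prod.mk.injEq]
  tauto

theorem Gph.edge_inv (i j : Fin 3) (v u : G.V) (h : (j, u) ∈ G.edge i v) :
    (j, G.s j u) ∈ G.edge i v := by
  rw [Gph.mem_edge] at h ⊢
  obtain ⟨rfl, rfl | rfl⟩ := h
  · exact ⟨rfl, Or.inr rfl⟩
  · exact ⟨rfl, Or.inl (G.inv _ _)⟩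

theorem Gph.card_edge (i : Fin 3) (v : G.V) : (G.edge i v).card = 2 := by
  unfold Gph.edge
  refine Finset.card_pair ?_
  simpa using (G.s_ne i v).symm

theorem Gph.par_edge (i : Fin 3) (v u : G.V) :
    G.par (G.edge i v) u = G.del v u + G.del (G.s i v) u := by
  unfold Gph.par
  rw [Finset.sum_eq_single i]
  · have := G.s_ne i v
    by_cases h1 : u = v
    · subst h1
      simp [Gph.mem_edge, Gph.del, this.symm]
    · simp [Gph.mem_edge, Gph.del, h1]
  · intro j _ hj
    simp [Gph.mem_edge, hj]
  · simp

/-- Move along the edge of color `i`. -/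
def Gph.Y.nb {G : Gph n} (x : G.Y) (i : Fin 3) : G.Y where
  c := symmDiff x.c (G.edge i x.p)
  p := G.s i x.p
  cinv j v h := by
    have h1 := Gph.cinv_iff x j v
    have h2 : (j, G.s j v) ∈ G.edge i x.p ↔ (j, v) ∈ G.edge i x.p :=
      ⟨fun h => by simpa [G.inv] using G.edge_inv _ _ _ _ h, G.edge_inv i j x.p v⟩
    simpa only [Finset.mem_symmDiff, h1, h2] using h
  hp v := by
    rw [G.par_symmDiff, x.hp, G.par_edge]
    have := zmod2_add_self (G.del x.p v)
    linear_combination this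

theorem Gph.Y.nb_nb {G : Gph n} (x : G.Y) (i : Fin 3) : (x.nb i).nb i = x := by
  apply Gph.Y.ext_c
  have : G.edge i (G.s i x.p) = G.edge i x.p := by
    ext ⟨j, u⟩
    simp only [Gph.mem_edge, G.inv]
    tauto
  change symmDiff (symmDiff x.c (G.edge i x.p)) (G.edge i (G.s i x.p)) = x.c
  rw [this, symmDiff_assoc, symmDiff_self]
  simp

theorem Gph.Y.diff_nb {G : Gph n} (x : G.Y) (i : Fin 3) :
    symmDiff x.c (x.nb i).c = G.edge i x.p := by
  change symmDiff x.c (symmDiff x.c (G.edge i x.p)) = _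
  rw [← symmDiff_assoc, symmDiff_self]
  simp

/-- The flag of `nb` is crossed iff the flag of `x` is not. -/
theorem Gph.Y.flag_nb {G : Gph n} (x z : G.Y) (i : Fin 3) :
    (i, (x.nb i).p) ∈ symmDiff (x.nb i).c z.c ↔ (i, x.p) ∉ symmDiff x.c z.c := by
  have h1 : (i, (x.nb i).p) ∈ symmDiff (x.nb i).c z.c ↔ (i, x.p) ∈ symmDiff (x.nb i).c z.c := by
    change (i, G.s i x.p) ∈ _ ↔ _
    simp only [Finset.mem_symmDiff, Gph.cinv_iff]
  have h2 : (i, x.p) ∈ (x.nb i).c ↔ (i, x.p) ∉ x.c := by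
    change (i, x.p) ∈ symmDiff _ _ ↔ _
    simp [Finset.mem_symmDiff, Gph.mem_edge]
  rw [h1]
  simp only [Finset.mem_symmDiff, h2]
  tauto

theorem Gph.Y.card_nb {G : Gph n} (x z : G.Y) (i : Fin 3) (h : (i, x.p) ∈ symmDiff x.c z.c) :
    (symmDiff (x.nb i).c z.c).card + 1 ≤ (symmDiff x.c z.c).card := by
  have hsub : G.edge i x.p ⊆ symmDiff x.c z.c := by
    rintro ⟨j, u⟩ hu
    rw [Gph.mem_edge] at hu
    obtain ⟨rfl, rfl | rfl⟩ := hu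
    · exact h
    · exact Gph.diff_inv x z _ _ h
  have : symmDiff (x.nb i).c z.c ⊆ (symmDiff x.c z.c).erase (i, x.p) := by
    intro f hf
    have hf' : f ∈ symmDiff (symmDiff x.c (G.edge i x.p)) z.c := hf
    rw [symmDiff_right_comm] at hf'
    rcases Finset.mem_symmDiff.1 hf' with ⟨h1, h2⟩ | ⟨h1, h2⟩
    · refine Finset.mem_erase.2 ⟨?_, h1⟩
      rintro rfl
      exact h2 (by simp [Gph.mem_edge])
    · exact absurd (hsub h1) h2
  have h3 := Finset.card_le_card this
  rw [Finset.card_erase_of_mem h] at h3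
  have : 0 < (symmDiff x.c z.c).card := Finset.card_pos.2 ⟨_, h⟩
  omega

def Gph.Y.zero (G : Gph n) : G.Y where
  c := ∅
  p := G.base
  cinv := by simp
  hp v := by rw [zmod2_add_self]; simp [Gph.par]

end Construction

section Space

abbrev Iota : Type := (Σ n : ℕ, Fin 3 × (gph n).V) ⊕ ℕ

abbrev XX : Type := Σ n : ℕ, (gph n).Y

noncomputable instance : DecidableEq Iota := Classical.decEq _

def lev (n : ℕ) : Fin 3 × (gph n).V ↪ Iota :=
  ⟨fun f => Sum.inl ⟨n, f⟩, fun a b h => by simpa using h⟩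

theorem lev_apply (n : ℕ) (f) : lev n f = Sum.inl ⟨n, f⟩ := rfl

noncomputable def FF (x : XX) : Finset Iota :=
  x.2.c.map (lev x.1) ∪ (Finset.range (x.1 ^ 2)).map Function.Embedding.inr

theorem inl_mem_FF (n : ℕ) (x : (gph n).Y) (f) :
    (Sum.inl ⟨n, f⟩ : Iota) ∈ FF ⟨n, x⟩ ↔ f ∈ x.c := by
  simp [FF, lev_apply]

theorem inl_mem_FF' (n m : ℕ) (x : (gph n).Y) (f) (h : (Sum.inl ⟨m, f⟩ : Iota) ∈ FF ⟨n, x⟩) :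
    n = m := by
  simp only [FF, lev_apply, Finset.mem_union, Finset.mem_map, Sum.inl.injEq] at h
  rcases h with ⟨a, -, h⟩ | ⟨a, -, h⟩
  · exact congrArg Sigma.fst h
  · cases h

theorem inr_mem_FF (x : XX) (k : ℕ) : (Sum.inr k : Iota) ∈ FF x ↔ k < x.1 ^ 2 := by
  simp [FF, lev_apply]

noncomputable def nd (x y : XX) : ℕ := (symmDiff (FF x) (FF y)).card

theorem nd_same (n : ℕ) (x y : (gph n).Y) :
    nd ⟨n, x⟩ ⟨n, y⟩ = (symmDiff x.c y.c).card := by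
  unfold nd
  rw [← Finset.card_map (lev n)]
  congr 1
  ext a
  rcases a with ⟨m, f⟩ | k
  · by_cases h : n = m
    · subst h
      simp only [Finset.mem_symmDiff, inl_mem_FF]
      simp [lev_apply, Finset.mem_symmDiff]
    · have h1 : (Sum.inl ⟨m, f⟩ : Iota) ∉ FF ⟨n, x⟩ := fun hh => h (inl_mem_FF' _ _ _ _ hh)
      have h2 : (Sum.inl ⟨m, f⟩ : Iota) ∉ FF ⟨n, y⟩ := fun hh => h (inl_mem_FF' _ _ _ _ hh)
      simp only [Finset.mem_symmDiff, h1, h2, Finset.mem_map]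
      simp only [false_and, or_self, false_iff]
      rintro ⟨a, -, ha⟩
      have : (⟨n, a⟩ : Σ n : ℕ, Fin 3 × (gph n).V) = ⟨m, f⟩ := Sum.inl_injective ha
      exact h (congrArg Sigma.fst this)
  · simp [Finset.mem_symmDiff, inr_mem_FF, lev_apply]

theorem nd_comm (x y : XX) : nd x y = nd y x := by
  unfold nd; rw [symmDiff_comm]

theorem nd_lt (x y : XX) (h : x.1 < y.1) : y.1 ≤ nd x y := by
  have h1 : (Finset.Ico (x.1 ^ 2) (y.1 ^ 2)).map (Function.Embedding.inr : ℕ ↪ Iota) ⊆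
      symmDiff (FF x) (FF y) := by
    intro a ha
    simp only [Finset.mem_map, Finset.mem_Ico] at ha
    obtain ⟨k, ⟨hk1, hk2⟩, rfl⟩ := ha
    refine Finset.mem_symmDiff.2 (Or.inr ⟨(inr_mem_FF _ _).2 hk2, fun hh => ?_⟩)
    have := (inr_mem_FF _ _).1 hh
    omega
  have h2 := Finset.card_le_card h1
  rw [Finset.card_map, Nat.card_Ico] at h2
  refine le_trans ?_ h2
  have h3 : x.1 ^ 2 + y.1 ≤ y.1 ^ 2 := by nlinarith
  omega

theorem nd_ne (x y : XX) (h : x.1 ≠ y.1) : x.1 ≤ nd x y ∧ y.1 ≤ nd x y := by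
  rcases lt_or_gt_of_ne h with h | h
  · have := nd_lt x y h
    omega
  · have := nd_lt y x h
    rw [nd_comm] at this
    omega

theorem nd_eq_zero (x y : XX) (h : nd x y = 0) : x = y := by
  have hF : FF x = FF y := symmDiff_eq_bot.1 (Finset.card_eq_zero.1 h)
  have h1 : x.1 = y.1 := by
    by_contra hne
    have := nd_ne x y hne
    omega
  obtain ⟨n, x⟩ := x
  obtain ⟨m, y⟩ := y
  simp only at h1
  subst h1
  rw [nd_same] at h
  rw [Gph.Y.ext_c (symmDiff_eq_bot.1 (Finset.card_eq_zero.1 h))]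

theorem nd_triangle (x y z : XX) : nd x z ≤ nd x y + nd y z := by
  unfold nd
  refine le_trans (Finset.card_le_card ?_) (Finset.card_union_le _ _)
  exact symmDiff_triangle _ _ _

noncomputable def metXX : MetricSpace XX where
  dist x y := (nd x y : ℝ)
  dist_self x := by simp [nd]
  dist_comm x y := by rw [nd_comm]
  dist_triangle x y z := by exact_mod_cast nd_triangle x y z
  eq_of_dist_eq_zero := by
    intro x y h
    exact nd_eq_zero x y (by exact_mod_cast h)

theorem ball_large (r : ℕ) : ∀ n, r < n → ∀ x : (gph n).Y, ∃ T : Finset XX,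
    T.card ≤ 4 ^ r ∧ ∀ z : XX, nd ⟨n, x⟩ z ≤ r → z ∈ T := by
  classical
  induction r with
  | zero =>
    intro n _ x
    refine ⟨{⟨n, x⟩}, by simp, fun z hz => ?_⟩
    rw [Finset.mem_singleton]
    exact (nd_eq_zero _ _ (by omega)).symm
  | succ r ih =>
    intro n hn x
    choose T hT1 hT2 using fun i => ih n (by omega) (x.nb i)
    refine ⟨insert ⟨n, x⟩ (Finset.univ.biUnion T), ?_, ?_⟩
    · have h1 := Finset.card_insert_le (⟨n, x⟩ : XX) (Finset.univ.biUnion T)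
      have h2 : (Finset.univ.biUnion T).card ≤ 3 * 4 ^ r := by
        refine le_trans Finset.card_biUnion_le ?_
        refine le_trans (Finset.sum_le_sum (fun i _ => hT1 i)) ?_
        simp
      have h3 : 0 < 4 ^ r := by positivity
      rw [pow_succ]
      omega
    · intro z hz
      by_cases hne : z = ⟨n, x⟩
      · simp [hne]
      · have h1 : n = z.1 := by
          by_contra hh
          have := nd_ne ⟨n, x⟩ z hh
          simp only at this
          omega
        obtain ⟨m, z⟩ := z
        simp only at h1
        subst h1
        rw [nd_same] at hz
        obtain ⟨i, hi⟩ := Gph.exists_flag x z (by omega) (by rintro rfl; exact hne rfl)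
        have h2 := Gph.Y.card_nb x z i hi
        refine Finset.mem_insert_of_mem (Finset.mem_biUnion.2 ⟨i, Finset.mem_univ _, ?_⟩)
        refine hT2 i _ ?_
        rw [nd_same]
        omega

theorem ball_bound (r : ℕ) : ∃ N : ℕ, ∀ x : XX,
    {z : XX | nd x z ≤ r}.Finite ∧ {z : XX | nd x z ≤ r}.ncard ≤ N := by
  have hfin : {z : XX | z.1 ≤ r}.Finite := by
    have : {z : XX | z.1 ≤ r} ⊆ ⋃ m ∈ Set.Iic r, Set.range (fun y : (gph m).Y => (⟨m, y⟩ : XX)) := by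
      rintro ⟨m, y⟩ hz
      simp only [Set.mem_iUnion]
      exact ⟨m, hz, y, rfl⟩
    refine Set.Finite.subset ?_ this
    exact (Set.finite_Iic r).biUnion (fun m _ => Set.finite_range _)
  refine ⟨4 ^ r + {z : XX | z.1 ≤ r}.ncard, fun x => ?_⟩
  by_cases hx : r < x.1
  · obtain ⟨T, hT1, hT2⟩ := ball_large r x.1 hx x.2
    have hsub : {z : XX | nd x z ≤ r} ⊆ (T : Set XX) := fun z hz => hT2 z hz
    refine ⟨T.finite_toSet.subset hsub, ?_⟩
    have := Set.ncard_le_ncard hsub T.finite_toSet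
    rw [Set.ncard_coe_finset] at this
    omega
  · have hsub : {z : XX | nd x z ≤ r} ⊆ {z : XX | z.1 ≤ r} := by
      intro z hz
      simp only [Set.mem_ofPred_eq] at hz ⊢
      by_cases h : x.1 = z.1
      · omega
      · have := nd_ne x z h
        omega
    refine ⟨hfin.subset hsub, ?_⟩
    exact (Set.ncard_le_ncard hsub hfin).trans (Nat.le_add_left _ _)

noncomputable def emb (x : XX) : lp (fun _ : Iota => ℝ) 2 :=
  ∑ i ∈ FF x, lp.single 2 i (1 : ℝ)

theorem emb_norm (x y : XX) : ‖emb x - emb y‖ ^ 2 = nd x y := by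
  have hval : ∀ (A : Finset Iota) (j : Iota),
      (∑ i ∈ A, lp.single (E := fun _ : Iota => ℝ) 2 i (1 : ℝ)) j = if j ∈ A then 1 else 0 := by
    intro A j
    rw [lp.coeFn_sum, Finset.sum_apply]
    simp [lp.single_apply, Pi.single_apply]
  have h := lp.norm_rpow_eq_tsum (p := 2) (by norm_num) (emb x - emb y)
  simp only [ENNReal.toReal_ofNat, Real.rpow_ofNat] at h
  rw [h, tsum_eq_sum (s := symmDiff (FF x) (FF y))]
  · rw [Finset.sum_congr rfl (g := fun _ => (1 : ℝ))]
    · simp [nd]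
    · intro j hj
      rw [lp.coeFn_sub, Pi.sub_apply, emb, emb, hval, hval]
      rcases Finset.mem_symmDiff.1 hj with ⟨h1, h2⟩ | ⟨h1, h2⟩ <;> simp [h1, h2]
  · intro j hj
    rw [lp.coeFn_sub, Pi.sub_apply, emb, emb, hval, hval]
    rw [Finset.mem_symmDiff] at hj
    by_cases h1 : j ∈ FF x <;> by_cases h2 : j ∈ FF y <;> simp [h1, h2] at hj ⊢

theorem emb_coarse : IsCoarseEmbedding (fun x y : XX => (nd x y : ℝ)) emb := by
  intro x y
  have h1 : (fun n => ((nd (x n) (y n) : ℕ) : ℝ)) =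
      fun n => ‖emb (x n) - emb (y n)‖ ^ 2 := by
    funext n
    rw [emb_norm]
  simp only [h1]
  constructor
  · intro h
    have h2 := Real.tendsto_sqrt_atTop.comp h
    refine h2.congr fun n => ?_
    simp [Real.sqrt_sq]
  · intro h
    exact (Filter.tendsto_pow_atTop (by norm_num)).comp h

theorem ratio_bound {α : Type} [DecidableEq α] (A B : Finset α)
    (h : ((symmDiff A B).card : ℝ) < 1 / 4 * ((A ∩ B).card : ℝ)) (P Q : Finset α)
    (hPQ : ∀ a, a ∈ A → a ∈ B → a ∈ P ∨ a ∈ Q) :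
    (4 / 5 : ℝ) ≤ (P.card : ℝ) / A.card + (Q.card : ℝ) / B.card := by
  have hA : A.card ≤ (A ∩ B).card + (symmDiff A B).card := by
    refine le_trans (Finset.card_le_card ?_) (Finset.card_union_le _ _)
    intro a ha
    simp only [Finset.mem_union, Finset.mem_inter, Finset.mem_symmDiff]
    tauto
  have hB : B.card ≤ (A ∩ B).card + (symmDiff A B).card := by
    refine le_trans (Finset.card_le_card ?_) (Finset.card_union_le _ _)
    intro a ha
    simp only [Finset.mem_union, Finset.mem_inter, Finset.mem_symmDiff]
    tauto
  have hI : (A ∩ B).card ≤ P.card + Q.card := by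
    refine le_trans (Finset.card_le_card ?_) (Finset.card_union_le _ _)
    intro a ha
    rw [Finset.mem_inter] at ha
    exact Finset.mem_union.2 (hPQ a ha.1 ha.2)
  have hIA : (A ∩ B).card ≤ A.card := Finset.card_le_card Finset.inter_subset_left
  have hIB : (A ∩ B).card ≤ B.card := Finset.card_le_card Finset.inter_subset_right
  have hA' : (A.card : ℝ) ≤ (A ∩ B).card + (symmDiff A B).card := by exact_mod_cast hA
  have hB' : (B.card : ℝ) ≤ (A ∩ B).card + (symmDiff A B).card := by exact_mod_cast hB
  have hI' : ((A ∩ B).card : ℝ) ≤ P.card + Q.card := by exact_mod_cast hI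
  have hIA' : ((A ∩ B).card : ℝ) ≤ A.card := by exact_mod_cast hIA
  have hIB' : ((A ∩ B).card : ℝ) ≤ B.card := by exact_mod_cast hIB
  have h0 : (0 : ℝ) ≤ (symmDiff A B).card := by positivity
  have hpos : (0 : ℝ) < (A ∩ B).card := by linarith
  set I : ℝ := ((A ∩ B).card : ℝ)
  have e1 : (P.card : ℝ) / (5 / 4 * I) ≤ (P.card : ℝ) / A.card :=
    div_le_div_of_nonneg_left (by positivity) (by linarith) (by linarith)
  have e2 : (Q.card : ℝ) / (5 / 4 * I) ≤ (Q.card : ℝ) / B.card :=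
    div_le_div_of_nonneg_left (by positivity) (by linarith) (by linarith)
  have e3 : (4 / 5 : ℝ) ≤ (P.card : ℝ) / (5 / 4 * I) + (Q.card : ℝ) / (5 / 4 * I) := by
    rw [← add_div, le_div_iff₀ (by positivity)]
    linarith
  linarith

theorem not_propA : ¬ HasPropertyA (fun x y : XX => (nd x y : ℝ)) := by
  intro hA
  unfold HasPropertyA at hA
  obtain ⟨A, S, hS, hne, hsym, hsupp⟩ := hA (1 / 4) (by norm_num) 2 (by norm_num)
  obtain ⟨n, hn⟩ := exists_nat_gt S
  haveI : Fintype (gph n).Y := Fintype.ofFinite _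
  classical
  -- the flag crossed
  let P : (gph n).Y → Fin 3 → Finset (XX × ℕ) := fun x i =>
    (A ⟨n, x⟩).filter (fun q => (Sum.inl ⟨n, (i, x.p)⟩ : Iota) ∈ symmDiff (FF ⟨n, x⟩) (FF q.1))
  have hlev : ∀ (x : (gph n).Y) (q : XX × ℕ), q ∈ A ⟨n, x⟩ → ∃ z : (gph n).Y, q.1 = ⟨n, z⟩ ∧
      (symmDiff x.c z.c).card ≤ n := by
    rintro x ⟨⟨m, z⟩, k⟩ hq
    have h1 := hsupp _ _ hq
    have h2 : nd ⟨n, x⟩ ⟨m, z⟩ < n := by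
      have : (nd ⟨n, x⟩ ⟨m, z⟩ : ℝ) < n := lt_of_le_of_lt h1 hn
      exact_mod_cast this
    have h3 : n = m := by
      by_contra hh
      have := (nd_ne ⟨n, x⟩ ⟨m, z⟩ hh).1
      simp only at this
      omega
    subst h3
    refine ⟨z, rfl, ?_⟩
    rw [nd_same] at h2
    omega
  have hflag : ∀ (x z : (gph n).Y) (f : Fin 3 × (gph n).V),
      (Sum.inl ⟨n, f⟩ : Iota) ∈ symmDiff (FF ⟨n, x⟩) (FF ⟨n, z⟩) ↔ f ∈ symmDiff x.c z.c := by
    intro x z f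
    simp only [Finset.mem_symmDiff, inl_mem_FF]
  let φ : (gph n).Y → Fin 3 → ℝ := fun x i => ((P x i).card : ℝ) / (A ⟨n, x⟩).card
  have hsum : ∀ x, ∑ i, φ x i ≤ 1 := by
    intro x
    have hpos : (0 : ℝ) < (A ⟨n, x⟩).card := by
      exact_mod_cast Finset.card_pos.2 (hne ⟨n, x⟩)
    simp only [φ]
    rw [← Finset.sum_div, div_le_one hpos]
    rw [← Nat.cast_sum]
    have hdisj : ((Finset.univ : Finset (Fin 3)) : Set (Fin 3)).PairwiseDisjoint (P x) := by
      intro i _ j _ hij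
      refine Finset.disjoint_left.2 fun q hqi hqj => hij ?_
      obtain ⟨hqA, hqi⟩ := Finset.mem_filter.1 hqi
      obtain ⟨-, hqj⟩ := Finset.mem_filter.1 hqj
      obtain ⟨z, hz, hcard⟩ := hlev x q hqA
      rw [hz, hflag] at hqi hqj
      exact Gph.unique_flag x z hcard i j hqi hqj
    rw [← Finset.card_biUnion hdisj]
    have : Finset.univ.biUnion (P x) ⊆ A ⟨n, x⟩ :=
      Finset.biUnion_subset.2 fun i _ => Finset.filter_subset _ _
    exact_mod_cast Finset.card_le_card this
  have hedge : ∀ x i, (4 / 5 : ℝ) ≤ φ x i + φ (x.nb i) i := by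
    intro x i
    have hd : (nd ⟨n, x⟩ ⟨n, x.nb i⟩ : ℝ) ≤ 2 := by
      rw [nd_same, Gph.Y.diff_nb, Gph.card_edge]
      norm_num
    refine @ratio_bound _ (Classical.decEq _) (A ⟨n, x⟩) (A ⟨n, x.nb i⟩) (hsym _ _ hd) _ _ ?_
    intro q hq1 hq2
    obtain ⟨z, hz, -⟩ := hlev x q hq1
    by_cases hc : (i, x.p) ∈ symmDiff x.c z.c
    · left
      refine Finset.mem_filter.2 ⟨hq1, ?_⟩
      rw [hz, hflag]
      exact hc
    · right
      refine Finset.mem_filter.2 ⟨hq2, ?_⟩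
      rw [hz, hflag]
      exact (Gph.Y.flag_nb x z i).2 hc
  have hperm : ∀ i, ∑ x : (gph n).Y, φ (x.nb i) i = ∑ x : (gph n).Y, φ x i := by
    intro i
    have hinv : Function.Involutive (fun x : (gph n).Y => x.nb i) := fun x => Gph.Y.nb_nb x i
    exact Equiv.sum_comp hinv.toPerm (fun x => φ x i)
  have htot : ∑ i : Fin 3, ∑ x : (gph n).Y, (4 / 5 : ℝ) ≤
      ∑ i : Fin 3, ∑ x : (gph n).Y, (φ x i + φ (x.nb i) i) :=
    Finset.sum_le_sum fun i _ => Finset.sum_le_sum fun x _ => hedge x i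
  simp only [Finset.sum_add_distrib, hperm] at htot
  rw [Finset.sum_comm (f := fun i x => φ x i)] at htot
  have hle : ∑ x, ∑ i, φ x i ≤ ∑ x : (gph n).Y, (1 : ℝ) :=
    Finset.sum_le_sum fun x _ => hsum x
  simp only [Finset.sum_const, Finset.card_univ, Fintype.card_fin, nsmul_eq_mul, mul_one]
    at htot hle
  have hpos : (0 : ℝ) < Fintype.card (gph n).Y := by
    exact_mod_cast Fintype.card_pos_iff.2 ⟨Gph.Y.zero _⟩
  push_cast at htot
  linarith

end Space

/-- There exists a uniformly discrete metric space of bounded geometry which coarsely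
embeds into a Hilbert space but does not have Property A. -/
theorem exists_space_coarsely_embeddable_without_propertyA :
    ∃ (X : Type) (_ : MetricSpace X),
      (∃ c : ℝ, 0 < c ∧ ∀ x y : X, x ≠ y → c ≤ dist x y) ∧
      (∀ r : ℝ, 0 < r → ∃ N : ℕ, ∀ x : X,
        (Metric.closedBall x r).Finite ∧ (Metric.closedBall x r).ncard ≤ N) ∧
      CoarselyEmbeddableIntoHilbert (fun x y : X => dist x y) ∧
      ¬ HasPropertyA (fun x y : X => dist x y) := by
  refine ⟨XX, metXX, ⟨1, one_pos, ?_⟩, ?_, ?_, not_propA⟩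
  · intro x y hxy
    change (1 : ℝ) ≤ (nd x y : ℝ)
    have : nd x y ≠ 0 := fun h => hxy (nd_eq_zero x y h)
    exact_mod_cast Nat.one_le_iff_ne_zero.2 this
  · intro r hr
    obtain ⟨N, hN⟩ := ball_bound ⌊r⌋₊
    refine ⟨N, fun x => ?_⟩
    have h : @Metric.closedBall XX metXX.toPseudoMetricSpace x r =
        {z : XX | nd x z ≤ ⌊r⌋₊} := by
      ext z
      change (nd z x : ℝ) ≤ r ↔ nd x z ≤ ⌊r⌋₊
      rw [nd_comm, Nat.le_floor_iff hr.le]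
    rw [h]
    exact hN x
  · exact ⟨lp (fun _ : Iota => ℝ) 2, inferInstance, inferInstance, inferInstance, emb, emb_coarse⟩
end

section
/- Let Γ₀ = F₂ be the free group of rank two, and inductively let Γ_n = Γ_{n−1}^{(2)} be the normal subgroup of Γ_{n−1} generated by all squares of elements of Γ_{n−1}. Let X_n be the Cayley graph of F₂/Γ_n with respect to the images of the two canonical generators, and let (X, d_X) be the coarse disjoint union of the X_n (each X_n carries its graph metric, and d_X(X_n, X_m) = diam(X_n) + diam(X_m) + n + m for n ≠ m). Then the metric space (X, d_X) coarsely embeds into a Hilbert space but does not have Property A. -/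
/-- The subgroup `Γ^{(2)}` of a group `Γ`: the normal subgroup generated by the
squares of all elements of `Γ`. -/
def sqNormal (Γ : Type) [Group Γ] : Subgroup Γ :=
  Subgroup.normalClosure {x : Γ | ∃ g : Γ, x = g ^ 2}

/-- The free group of rank two. -/
abbrev F2 : Type := FreeGroup (Fin 2)

/-- The sequence `Γ₀ = F₂`, `Γ_n = Γ_{n-1}^{(2)}`, each viewed as a subgroup of `F₂`. -/
def Gamma : ℕ → Subgroup F2
  | 0 => ⊤
  | n + 1 => (sqNormal (Gamma n)).map (Gamma n).subtype

/-- The word length of an element of `F₂` with respect to the two canonical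
generators and their inverses, i.e. the length of the reduced word. -/
def wordLen (g : F2) : ℕ := (FreeGroup.toWord g).length

/-- The graph metric on the Cayley graph `X_n` of `F₂/Γ_n` with respect to the images
of the canonical generators: the distance between two cosets is the least word length
of `a⁻¹ * b` over representatives `a`, `b`. -/
noncomputable def qdist (n : ℕ) (x y : F2 ⧸ Gamma n) : ℕ :=
  sInf {k : ℕ | ∃ a b : F2, QuotientGroup.mk a = x ∧ QuotientGroup.mk b = y ∧
    wordLen (a⁻¹ * b) = k}

/-- The diameter of the Cayley graph `X_n` of `F₂/Γ_n`. -/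
noncomputable def qdiam (n : ℕ) : ℕ :=
  sSup {k : ℕ | ∃ x y : F2 ⧸ Gamma n, qdist n x y = k}

/-- The box space: the disjoint union of the Cayley graphs `X_n` of `F₂/Γ_n`. -/
def BoxSpace : Type := Σ n : ℕ, F2 ⧸ Gamma n

/-- The metric `d_X` of the box space: on each `X_n` it is the graph metric, and
`d_X(X_n, X_m) = diam X_n + diam X_m + n + m` for `n ≠ m`. -/
noncomputable def boxDist (p q : BoxSpace) : ℕ :=
  if h : p.1 = q.1 then qdist q.1 (h ▸ p.2) q.2
  else qdiam p.1 + qdiam q.1 + p.1 + q.1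

set_option linter.unusedSectionVars false

namespace BoxAux

open FreeGroup hiding map_mul map_one map_inv

section Generic

variable {Q : Type} [Group Q] (π : F2 →* Q)

/-- The elementary chain supported on one element. -/
noncomputable def dl {E : Type} (e : E) : E → ZMod 2 :=
  open Classical in fun e' => if e' = e then 1 else 0

lemma dl_self {E : Type} (e : E) : dl e e = 1 := by simp [dl]

lemma dl_ne {E : Type} {e e' : E} (h : e' ≠ e) : dl e e' = 0 := by simp [dl, h]

lemma dl_congr {E F : Type} {e e' : E} {f f' : F} (h : e' = e ↔ f' = f) :
    dl e e' = dl f f' := by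
  by_cases h1 : e' = e
  · simp [dl, h1, h.1 h1]
  · simp [dl, h1, mt h.2 h1]

lemma two_zero {E : Type} (c : E → ZMod 2) : c + c = 0 := by
  funext e; exact CharTwo.add_self_eq_zero _

/-- The (undirected) edge crossed from the vertex `v` along the letter `x`. -/
def edge (v : Q) (x : Fin 2 × Bool) : Q × Fin 2 :=
  if x.2 then (v, x.1) else (v * (π (of x.1))⁻¹, x.1)

/-- The mod 2 chain of the path starting at `v` and labelled by a word. -/
noncomputable def path : Q → List (Fin 2 × Bool) → (Q × Fin 2 → ZMod 2)
  | _, [] => 0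
  | v, x :: L => dl (edge π v x) + path (v * π (FreeGroup.mk [x])) L

lemma mk_cons (x : Fin 2 × Bool) (L : List (Fin 2 × Bool)) :
    (FreeGroup.mk (x :: L) : F2) = FreeGroup.mk [x] * FreeGroup.mk L := by
  simp [FreeGroup.mul_mk]

lemma path_append (v : Q) (L₁ L₂ : List (Fin 2 × Bool)) :
    path π v (L₁ ++ L₂) = path π v L₁ + path π (v * π (FreeGroup.mk L₁)) L₂ := by
  induction L₁ generalizing v with
  | nil => simp [path, ← FreeGroup.one_eq_mk]
  | cons x L ih =>
    rw [List.cons_append, path, path, ih, mk_cons x L, map_mul, mul_assoc, add_assoc]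

lemma mk_false (i : Fin 2) : (FreeGroup.mk [(i, false)] : F2) = (of i)⁻¹ := by
  simp [of, FreeGroup.inv_mk, FreeGroup.invRev]

lemma mk_true (i : Fin 2) : (FreeGroup.mk [(i, true)] : F2) = of i := rfl

lemma path_pair (v : Q) (i : Fin 2) (b : Bool) : path π v [(i, b), (i, !b)] = 0 := by
  have : edge π v (i, b) = edge π (v * π (FreeGroup.mk [(i, b)])) (i, !b) := by
    cases b <;> simp [edge, mk_false, mk_true]
  simp only [path, add_zero]
  rw [← this, two_zero]

lemma path_step (v : Q) {L₁ L₂ : List (Fin 2 × Bool)} (h : Red.Step L₁ L₂) :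
    path π v L₁ = path π v L₂ := by
  cases h with
  | @not A B i b =>
    rw [path_append, path_append,
      show ((i, b) :: (i, !b) :: B) = [(i, b), (i, !b)] ++ B from rfl, path_append, path_pair,
      zero_add]
    have : (FreeGroup.mk [(i, b), (i, !b)] : F2) = 1 := by
      rw [FreeGroup.one_eq_mk]
      exact Quot.sound (Red.Step.not (L₁ := []) (L₂ := []))
    rw [this, map_one, mul_one]

lemma path_red (v : Q) {L₁ L₂ : List (Fin 2 × Bool)} (h : Red L₁ L₂) :
    path π v L₁ = path π v L₂ := by
  induction h with
  | refl => rfl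
  | tail _ h ih => rw [ih, path_step π v h]

/-- The mod 2 chain of the path starting at `v` and labelled by `g`. -/
noncomputable def Phi (v : Q) (g : F2) : Q × Fin 2 → ZMod 2 := path π v g.toWord

lemma Phi_mk (v : Q) (L : List (Fin 2 × Bool)) : Phi π v (FreeGroup.mk L) = path π v L := by
  rw [Phi, toWord_mk]
  exact (path_red π v reduce.red).symm

lemma Phi_mul (v : Q) (g h : F2) : Phi π v (g * h) = Phi π v g + Phi π (v * π g) h := by
  conv_lhs => rw [← mk_toWord (x := g), ← mk_toWord (x := h), FreeGroup.mul_mk]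
  rw [Phi_mk, path_append, mk_toWord]; rfl

lemma Phi_one (v : Q) : Phi π v 1 = 0 := by simp [Phi, path]

lemma Phi_of (v : Q) (i : Fin 2) : Phi π v (of i) = dl (v, i) := by
  simp [Phi, path, edge]

lemma Phi_of_inv (v : Q) (i : Fin 2) : Phi π v (of i)⁻¹ = dl (v * (π (of i))⁻¹, i) := by
  rw [← mk_false, Phi_mk]; simp [path, edge]

lemma wordLen_mul (g h : F2) : wordLen (g * h) ≤ wordLen g + wordLen h := norm_mul_le g h

lemma wordLen_inv (g : F2) : wordLen g⁻¹ = wordLen g := norm_inv_eq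

lemma wordLen_of (i : Fin 2) : wordLen (of i) = 1 := norm_of i

lemma wordLen_mk (L : List (Fin 2 × Bool)) : wordLen (FreeGroup.mk L) ≤ L.length := norm_mk_le

lemma wordLen_reduced (L : List (Fin 2 × Bool)) (h : IsReduced L) :
    wordLen (FreeGroup.mk L) = L.length := by
  rw [wordLen, toWord_mk, h.reduce_eq]

/-- If the edge `e` occurs in the chain of a path, it is crossed by the path. -/
lemma path_occ (v : Q) (L : List (Fin 2 × Bool)) (e : Q × Fin 2) (h : path π v L e ≠ 0) :
    ∃ L₁ y L₂, L = L₁ ++ y :: L₂ ∧ edge π (v * π (FreeGroup.mk L₁)) y = e := by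
  induction L generalizing v with
  | nil => exact absurd rfl h
  | cons x L ih =>
    by_cases hx : edge π v x = e
    · exact ⟨[], x, L, rfl, by simpa [← FreeGroup.one_eq_mk] using hx⟩
    · have : path π (v * π (FreeGroup.mk [x])) L e ≠ 0 := by
        rw [path, Pi.add_apply, dl_ne (Ne.symm hx), zero_add] at h
        exact h
      obtain ⟨L₁, y, L₂, rfl, h2⟩ := ih _ this
      refine ⟨x :: L₁, y, L₂, rfl, ?_⟩
      rw [mk_cons, map_mul, ← mul_assoc]; exact h2

/-- The girth grows strictly. -/
lemma girth_step (g : F2) (hg : g ≠ 1) (h0 : Phi π 1 g = 0) :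
    ∃ g' : F2, g' ≠ 1 ∧ π g' = 1 ∧ wordLen g' < wordLen g := by
  have hred : IsReduced g.toWord := isReduced_toWord
  have hne : g.toWord ≠ [] := by simpa using hg
  rw [Phi] at h0
  rw [wordLen]
  generalize g.toWord = W at *
  rcases W with _ | ⟨x, L⟩
  · exact absurd rfl hne
  have h1 : path π (1 * π (FreeGroup.mk [x])) L (edge π 1 x) ≠ 0 := by
    intro h2
    have := congrFun h0 (edge π 1 x)
    rw [path, Pi.add_apply, h2, dl_self] at this
    simp at this
  obtain ⟨L₁, y, L₂, rfl, he⟩ := path_occ π _ _ _ h1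
  have hA : IsReduced (x :: L₁) := hred.infix ⟨[], y :: L₂, by simp⟩
  have hB : IsReduced L₁ := hred.infix ⟨[x], y :: L₂, by simp⟩
  have keyA : π (FreeGroup.mk (x :: L₁)) = 1 → ∃ g' : F2, g' ≠ 1 ∧ π g' = 1 ∧
      wordLen g' < (x :: (L₁ ++ y :: L₂)).length := by
    intro h
    refine ⟨_, ?_, h, ?_⟩
    · intro h'
      have := wordLen_reduced _ hA
      rw [h'] at this
      simp [wordLen] at this
    · rw [wordLen_reduced _ hA]; simp
  have keyB : x.1 = y.1 → x.2 ≠ y.2 → π (FreeGroup.mk L₁) = 1 → ∃ g' : F2, g' ≠ 1 ∧ π g' = 1 ∧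
      wordLen g' < (x :: (L₁ ++ y :: L₂)).length := by
    intro e1 e2 h
    refine ⟨_, ?_, h, ?_⟩
    · intro h'
      have := wordLen_reduced _ hB
      rw [h'] at this
      have h3 : L₁ = [] := by
        rw [← List.length_eq_zero_iff, ← this]; simp [wordLen]
      subst h3
      have : IsReduced [x, y] := hred.infix ⟨[], L₂, by simp⟩
      simp [FreeGroup.IsReduced] at this
      exact e2 (this e1)
    · rw [wordLen_reduced _ hB]; simp
  obtain ⟨i, b⟩ := x
  obtain ⟨j, b'⟩ := y
  rw [mk_cons, map_mul] at keyA
  have hij : i = j := by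
    have := congrArg Prod.snd he
    cases b <;> cases b' <;> simp [edge] at this <;> exact this.symm
  subst hij
  have h4 := congrArg Prod.fst he
  cases b <;> cases b' <;> simp [edge, mk_false, mk_true] at h4 keyA keyB ⊢
  · exact keyA h4
  · exact keyB h4
  · exact keyB h4
  · exact keyA h4

/-- Boundary of a chain. -/
noncomputable def bd (c : Q × Fin 2 → ZMod 2) (x : Q) : ZMod 2 :=
  ∑ i : Fin 2, (c (x, i) + c (x * (π (of i))⁻¹, i))

lemma bd_add (c d : Q × Fin 2 → ZMod 2) : bd π (c + d) = bd π c + bd π d := by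
  funext x
  simp only [bd, Pi.add_apply, ← Finset.sum_add_distrib]
  exact Finset.sum_congr rfl fun i _ => by ring

lemma bd_zero : bd π 0 = 0 := by funext x; simp [bd]

lemma bd_dl (q : Q) (i : Fin 2) : bd π (dl (q, i)) = dl q + dl (q * π (of i)) := by
  funext x
  simp only [bd, Pi.add_apply]
  rw [Finset.sum_eq_single i]
  · rw [dl_congr (e := (q, i)) (f := q) (f' := x) (by simp),
      dl_congr (e := (q, i)) (f := q * π (of i)) (f' := x) (by simp [mul_inv_eq_iff_eq_mul])]
  · intro j _ hj
    rw [dl_ne (by simp [hj]), dl_ne (by simp [hj]), add_zero]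
  · simp

lemma bd_Phi (v : Q) (g : F2) : bd π (Phi π v g) = dl v + dl (v * π g) := by
  induction g using FreeGroup.induction_on generalizing v with
  | C1 => rw [Phi_one, bd_zero, map_one, mul_one, two_zero]
  | of i => exact (congrArg _ (Phi_of π v i)).trans (bd_dl π v i)
  | inv_of i _ =>
    refine (congrArg _ (Phi_of_inv π v i)).trans ((bd_dl π _ i).trans ?_)
    rw [inv_mul_cancel_right, add_comm]
    simp only [map_inv]
  | mul g h hg hh =>
    rw [Phi_mul, bd_add, hg, hh, map_mul, ← mul_assoc]
    have := two_zero (dl (v * π g))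
    linear_combination (exp := 1) this

variable [Finite Q]

/-- Number of elements in the support of a chain. -/
noncomputable def wt (c : Q × Fin 2 → ZMod 2) : ℕ := {e | c e ≠ 0}.ncard

lemma zmod2_ne {x : ZMod 2} (h : x ≠ 0) : x = 1 := by
  revert x; decide

lemma wt_add_dl_mem (c : Q × Fin 2 → ZMod 2) (e : Q × Fin 2) (h : c e ≠ 0) :
    wt (c + dl e) + 1 = wt c := by
  have : {e' | c e' ≠ 0} = insert e {e' | (c + dl e) e' ≠ 0} := by
    ext e'
    by_cases he : e' = e
    · subst he; simpa using h
    · simp [he, dl_ne he]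
  rw [wt, wt, this, Set.ncard_insert_of_notMem _ (Set.toFinite _)]
  simp [dl_self, zmod2_ne h]
  decide

lemma wt_add_dl_not_mem (c : Q × Fin 2 → ZMod 2) (e : Q × Fin 2) (h : c e = 0) :
    wt (dl e + c) = wt c + 1 := by
  have h1 := wt_add_dl_mem (dl e + c) e (by simp [h, dl_self])
  rw [← h1, add_comm (dl e) c, add_assoc, two_zero, add_zero]

lemma wt_mono {c d : Q × Fin 2 → ZMod 2} (h : ∀ e, c e ≠ 0 → d e ≠ 0) : wt c ≤ wt d :=
  Set.ncard_le_ncard h (Set.toFinite _)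

lemma wt_zero : wt (0 : Q × Fin 2 → ZMod 2) = 0 := by simp [wt]

lemma wt_dl_add_le (c : Q × Fin 2 → ZMod 2) (e : Q × Fin 2) : wt (dl e + c) ≤ wt c + 1 := by
  by_cases h : c e = 0
  · rw [wt_add_dl_not_mem c e h]
  · have := wt_add_dl_mem c e h
    rw [add_comm (dl e) c]; omega

lemma wt_path_le (v : Q) (L : List (Fin 2 × Bool)) : wt (path π v L) ≤ L.length := by
  induction L generalizing v with
  | nil => simp [path, wt_zero]
  | cons x L ih =>
    rw [path]
    exact (wt_dl_add_le _ _).trans (by simpa using ih _)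

lemma wt_Phi_le (v : Q) (g : F2) : wt (Phi π v g) ≤ wordLen g := wt_path_le π v _

/-- Extraction of a simple path from a chain with boundary `v + u`. -/
lemma exists_path (k : ℕ) (c : Q × Fin 2 → ZMod 2) (hk : wt c ≤ k) (v u : Q)
    (hb : bd π c = dl v + dl u) :
    ∃ h : F2, v * π h = u ∧ (∀ e, Phi π v h e ≠ 0 → c e ≠ 0) ∧ wordLen h ≤ wt (Phi π v h) := by
  induction k generalizing c v with
  | zero =>
    by_cases huv : v = u
    · exact ⟨1, by simpa using huv, by simp [Phi_one], by simp [wordLen]⟩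
    · exfalso
      have h0 : {e | c e ≠ 0} = ∅ := by
        rw [← Set.ncard_eq_zero (Set.toFinite _)]; exact Nat.le_zero.mp hk
      have h1 : c = 0 := by
        funext e
        by_contra he
        have : e ∈ {e | c e ≠ 0} := he
        rw [h0] at this
        exact this
      have := congrFun hb v
      rw [h1, bd_zero, Pi.add_apply, dl_self, dl_ne huv] at this
      simp at this
  | succ k ih =>
    by_cases huv : v = u
    · exact ⟨1, by simpa using huv, by simp [Phi_one], by simp [wordLen]⟩
    · have h1 : bd π c v = 1 := by rw [hb, Pi.add_apply, dl_self, dl_ne huv, add_zero]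
      have : ∃ (x : F2) (e : Q × Fin 2), wordLen x ≤ 1 ∧ Phi π v x = dl e ∧ c e ≠ 0 := by
        by_contra hcon
        push Not at hcon
        have : bd π c v = 0 := by
          rw [bd]
          refine Finset.sum_eq_zero fun i _ => ?_
          rw [hcon (of i) (v, i) (wordLen_of i).le (Phi_of π v i),
            hcon (of i)⁻¹ _ (by rw [wordLen_inv, wordLen_of]) (Phi_of_inv π v i), add_zero]
        rw [this] at h1
        exact absurd h1 (by decide)
      obtain ⟨x, e, hx, hxe, hce⟩ := this
      have hw := wt_add_dl_mem c e hce
      obtain ⟨h, hh1, hh2, hh3⟩ := ih (c + dl e) (by omega) (v * π x) (by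
        rw [bd_add, hb, ← hxe, bd_Phi]
        have := two_zero (dl v)
        linear_combination (exp := 1) this)
      have hP : Phi π v (x * h) = dl e + Phi π (v * π x) h := by rw [Phi_mul, hxe]
      have he0 : Phi π (v * π x) h e = 0 := by
        by_contra hne
        apply hh2 e hne
        rw [Pi.add_apply, dl_self, zmod2_ne hce]; decide
      refine ⟨x * h, by rw [map_mul, ← mul_assoc, hh1], ?_, ?_⟩
      · intro e' he'
        by_cases hee : e' = e
        · rwa [hee]
        · rw [hP, Pi.add_apply, dl_ne hee, zero_add] at he'
          have := hh2 e' he'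
          rwa [Pi.add_apply, dl_ne hee, add_zero] at this
      · rw [hP, wt_add_dl_not_mem _ _ he0]
        have := wordLen_mul x h
        omega

/-- A nonzero cycle gives a short nontrivial element of the kernel. -/
lemma cycle_girth (c : Q × Fin 2 → ZMod 2) (hc : c ≠ 0) (hb : bd π c = 0) :
    ∃ g : F2, g ≠ 1 ∧ π g = 1 ∧ wordLen g ≤ wt c := by
  obtain ⟨⟨q, i⟩, he⟩ := Function.ne_iff.mp hc
  have he : c (q, i) ≠ 0 := he
  have hw := wt_add_dl_mem c _ he
  obtain ⟨h, h1, h2, h3⟩ := exists_path π _ (c + dl (q, i)) le_rfl (q * π (of i)) q (by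
    rw [bd_add, hb, bd_dl, zero_add, add_comm])
  have h4 : Phi π (q * π (of i)) h (q, i) = 0 := by
    by_contra hne
    apply h2 _ hne
    rw [Pi.add_apply, dl_self, zmod2_ne he]; decide
  refine ⟨of i * h, ?_, ?_, ?_⟩
  · intro h5
    have h6 := congrArg (fun g => Phi π q g (q, i)) h5
    simp only [Phi_mul, Phi_of, Phi_one, Pi.add_apply, dl_self, h4, Pi.zero_apply] at h6
    exact absurd h6 (by decide)
  · rw [map_mul]
    rw [mul_assoc] at h1
    simpa using h1
  · have := wordLen_mul (of i) h
    rw [wordLen_of] at this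
    have := wt_mono h2
    omega

/-- The wall metric is the graph metric at scales below the girth. -/
lemma wall_lower (n : ℕ) (hn : ∀ g : F2, g ≠ 1 → π g = 1 → n ≤ wordLen g) (v : Q) (g : F2)
    (hg : wt (Phi π v g) < n) :
    ∃ h : F2, π h = π g ∧ Phi π v h = Phi π v g ∧ wordLen h ≤ wt (Phi π v g) := by
  obtain ⟨h, h1, h2, h3⟩ := exists_path π _ (Phi π v g) le_rfl v (v * π g) (bd_Phi π v g)
  refine ⟨h, by simpa using h1, ?_, h3.trans (wt_mono h2)⟩
  by_contra hne
  obtain ⟨g', a1, a2, a3⟩ := cycle_girth π (Phi π v h + Phi π v g) (by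
      intro h0
      apply hne
      have := two_zero (Phi π v g)
      linear_combination (exp := 1) h0 - this) (by
      rw [bd_add, bd_Phi, bd_Phi, h1, two_zero])
  have := hn g' a1 a2
  have : wt (Phi π v h + Phi π v g) ≤ wt (Phi π v g) := wt_mono (by
    intro e he h0
    rw [Pi.add_apply, h0, add_zero] at he
    exact h2 e he h0)
  omega

end Generic

section Tower

instance sqNormal_normal (Γ : Type) [Group Γ] : (sqNormal Γ).Normal :=
  Subgroup.normalClosure_normal

instance sqNormal_char (Γ : Type) [Group Γ] : (sqNormal Γ).Characteristic := by
  rw [Subgroup.characteristic_iff_map_le]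
  intro ϕ
  rw [Subgroup.map_le_iff_le_comap]
  have : (Subgroup.comap ϕ.toMonoidHom (sqNormal Γ)).Normal := Subgroup.normal_comap _
  refine Subgroup.normalClosure_le_normal ?_
  rintro _ ⟨g, rfl⟩
  exact Subgroup.subset_normalClosure ⟨ϕ g, by simp⟩

instance Gamma_normal (n : ℕ) : (Gamma n).Normal := by
  induction n with
  | zero => exact (inferInstance : (⊤ : Subgroup F2).Normal)
  | succ n ih =>
    exact (inferInstance : ((sqNormal (Gamma n)).map (Gamma n).subtype).Normal)

/-- The quotient map. -/
abbrev pr (n : ℕ) : F2 →* F2 ⧸ Gamma n := QuotientGroup.mk' (Gamma n)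

lemma pr_eq_one (n : ℕ) (g : F2) : pr n g = 1 ↔ g ∈ Gamma n := QuotientGroup.eq_one_iff g

lemma Gamma_succ_le (n : ℕ) : Gamma (n + 1) ≤ Gamma n := by
  rintro _ ⟨x, _, rfl⟩
  exact x.2

/-- The chains vanish on `Γ_{n+1}`. -/
lemma Phi_Gamma_succ (n : ℕ) (g : F2) (hg : g ∈ Gamma (n + 1)) (v : F2 ⧸ Gamma n) :
    Phi (pr n) v g = 0 := by
  let K : Subgroup (Gamma n) :=
    { carrier := {x | ∀ v, Phi (pr n) v (x : F2) = 0}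
      one_mem' := fun v => Phi_one _ v
      mul_mem' := by
        intro a b ha hb v
        rw [Subgroup.coe_mul, Phi_mul, ha, hb, add_zero]
      inv_mem' := by
        intro a ha v
        have h1 := Phi_mul (pr n) v (a : F2) (a : F2)⁻¹
        rw [mul_inv_cancel, Phi_one, ha, (pr_eq_one n a).2 a.2, mul_one, zero_add] at h1
        exact h1.symm }
  have hK : K.Normal := by
    refine ⟨fun k hk g v => ?_⟩
    have e1 : pr n (g : F2) = 1 := (pr_eq_one n g).2 g.2
    have e2 : pr n (k : F2) = 1 := (pr_eq_one n k).2 k.2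
    have h1 := Phi_mul (pr n) v (g : F2) (g : F2)⁻¹
    have hk : ∀ v, Phi (pr n) v (k : F2) = 0 := hk
    rw [mul_inv_cancel, Phi_one, e1, mul_one] at h1
    rw [Subgroup.coe_mul, Subgroup.coe_mul, Phi_mul, Phi_mul, hk, map_mul, e1, e2, mul_one, mul_one,
      add_zero, Subgroup.coe_inv]
    exact h1.symm
  obtain ⟨x, hx, rfl⟩ := hg
  have : sqNormal (Gamma n) ≤ K := by
    refine Subgroup.normalClosure_le_normal ?_
    rintro _ ⟨g, rfl⟩ v
    rw [sq, Subgroup.coe_mul, Phi_mul, (pr_eq_one n g).2 g.2, mul_one, two_zero]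
  exact this hx v

/-- The elementary abelian quotient `Γ_n/Γ_{n+1}`. -/
abbrev Ab (n : ℕ) : Type := Gamma n ⧸ sqNormal (Gamma n)

lemma Ab_sq (n : ℕ) (x : Ab n) : x * x = 1 := by
  obtain ⟨g, rfl⟩ := QuotientGroup.mk_surjective x
  rw [← QuotientGroup.mk_mul, QuotientGroup.eq_one_iff, ← sq]
  exact Subgroup.subset_normalClosure ⟨g, rfl⟩

noncomputable instance Ab_comm (n : ℕ) : CommGroup (Ab n) :=
  { (inferInstance : Group (Ab n)) with
    mul_comm := by
      intro a b
      have ha : a⁻¹ = a := inv_eq_of_mul_eq_one_left (Ab_sq n a)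
      have hb : b⁻¹ = b := inv_eq_of_mul_eq_one_left (Ab_sq n b)
      have hab : (a * b)⁻¹ = a * b := inv_eq_of_mul_eq_one_left (Ab_sq n (a * b))
      rw [mul_inv_rev, ha, hb] at hab
      exact hab.symm }

/-- A Schreier type cocycle. -/
noncomputable def T (n : ℕ) (v : F2 ⧸ Gamma n) (g : F2) : Gamma n :=
  ⟨v.out * g * (v * pr n g).out⁻¹, by
    rw [← pr_eq_one, map_mul, map_mul, map_inv]
    have h : ∀ q : F2 ⧸ Gamma n, pr n q.out = q := fun q => QuotientGroup.out_eq' q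
    rw [h, h, mul_inv_cancel]⟩

lemma T_mul (n : ℕ) (v : F2 ⧸ Gamma n) (g h : F2) :
    T n v (g * h) = T n v g * T n (v * pr n g) h := by
  apply Subtype.ext
  simp only [T, Subgroup.coe_mul, map_mul, mul_assoc, inv_mul_cancel_left]

lemma T_one (n : ℕ) (v : F2 ⧸ Gamma n) : T n v 1 = 1 := by
  apply Subtype.ext
  simp [T]

lemma T_inv (n : ℕ) (v : F2 ⧸ Gamma n) (g : F2) :
    T n v g⁻¹ = (T n (v * (pr n g)⁻¹) g)⁻¹ := by
  have h := T_mul n v g⁻¹ g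
  rw [inv_mul_cancel, T_one, map_inv] at h
  exact eq_inv_of_mul_eq_one_left h.symm

variable (n : ℕ) [Fintype ((F2 ⧸ Gamma n) × Fin 2)]

/-- The linear map from chains to `Γ_n/Γ_{n+1}`. -/
noncomputable def Lm (c : (F2 ⧸ Gamma n) × Fin 2 → ZMod 2) : Ab n :=
  ∏ e, (QuotientGroup.mk (T n e.1 (of e.2)) : Ab n) ^ (c e).val

lemma pow_val_add {A : Type} [CommGroup A] (a : A) (ha : a * a = 1) (x y : ZMod 2) :
    a ^ (x + y).val = a ^ x.val * a ^ y.val := by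
  rw [← pow_add, ZMod.val_add]
  exact (pow_eq_pow_mod _ (by rw [sq, ha])).symm

lemma Lm_add (c d : (F2 ⧸ Gamma n) × Fin 2 → ZMod 2) : Lm n (c + d) = Lm n c * Lm n d := by
  rw [Lm, Lm, Lm, ← Finset.prod_mul_distrib]
  exact Finset.prod_congr rfl fun e _ => pow_val_add _ (Ab_sq n _) _ _

lemma Lm_zero : Lm n 0 = 1 := by simp [Lm]

lemma Lm_dl (e : (F2 ⧸ Gamma n) × Fin 2) :
    Lm n (dl e) = (QuotientGroup.mk (T n e.1 (of e.2)) : Ab n) := by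
  rw [Lm, Finset.prod_eq_single e]
  · rw [dl_self, ZMod.val_one, pow_one]
  · intro e' _ he
    rw [dl_ne he]; simp
  · simp

lemma T_eq_Lm (v : F2 ⧸ Gamma n) (g : F2) :
    (QuotientGroup.mk (T n v g) : Ab n) = Lm n (Phi (pr n) v g) := by
  have hof : ∀ (v : F2 ⧸ Gamma n) (i : Fin 2),
      (QuotientGroup.mk (T n v (of i)) : Ab n) = Lm n (Phi (pr n) v (of i)) := by
    intro v i
    rw [Phi_of, Lm_dl]
  induction g using FreeGroup.induction_on generalizing v with
  | C1 => rw [T_one, Phi_one, Lm_zero]; rfl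
  | of i => exact hof v i
  | inv_of i _ =>
    change (QuotientGroup.mk (T n v (of i)⁻¹) : Ab n) = Lm n (Phi (pr n) v (of i)⁻¹)
    rw [Phi_of_inv, T_inv, Lm_dl, QuotientGroup.mk_inv]
    exact inv_eq_of_mul_eq_one_left (Ab_sq n _)
  | mul g h hg hh =>
    rw [T_mul, Phi_mul, Lm_add, ← hg, ← hh]
    rfl

end Tower

lemma mem_Gamma_succ_of_Phi (n : ℕ) [Finite (F2 ⧸ Gamma n)] (v : F2 ⧸ Gamma n) (g : F2) (hg : pr n g = 1)
    (h : Phi (pr n) v g = 0) : g ∈ Gamma (n + 1) := by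
  have := Fintype.ofFinite ((F2 ⧸ Gamma n) × Fin 2)
  have h1 := T_eq_Lm n v g
  rw [h, Lm_zero, QuotientGroup.eq_one_iff] at h1
  have h2 : (T n v g : F2) ∈ Gamma (n + 1) := ⟨_, h1, rfl⟩
  simp only [T, hg, mul_one] at h2
  have h3 := (Gamma_normal (n + 1)).conj_mem _ h2 v.out⁻¹
  simpa [mul_assoc] using h3


lemma mk_eq_iff (n : ℕ) (g h : F2) : pr n g = pr n h ↔ g⁻¹ * h ∈ Gamma n := QuotientGroup.eq

/-- The two coordinates which determine a point of `X_{n+1}`. -/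
lemma pr_succ_eq (n : ℕ) [Finite (F2 ⧸ Gamma n)] (v : F2 ⧸ Gamma n) (g h : F2)
    (h1 : pr n g = pr n h)
    (h2 : Phi (pr n) v g = Phi (pr n) v h) : pr (n + 1) g = pr (n + 1) h := by
  rw [mk_eq_iff]
  refine mem_Gamma_succ_of_Phi n (v * pr n g) _ (by rw [map_mul, map_inv, h1, inv_mul_cancel]) ?_
  have := Phi_mul (pr n) v g (g⁻¹ * h)
  rw [mul_inv_cancel_left, h2] at this
  exact left_eq_add.mp this

/-- Chains are well defined on `X_{n+1}`. -/
lemma Phi_congr (n : ℕ) (v : F2 ⧸ Gamma n) (g h : F2) (e : pr (n + 1) g = pr (n + 1) h) :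
    Phi (pr n) v g = Phi (pr n) v h := by
  rw [mk_eq_iff] at e
  have := Phi_mul (pr n) v g (g⁻¹ * h)
  rw [mul_inv_cancel_left, Phi_Gamma_succ n _ e, add_zero] at this
  exact this.symm

instance Q_finite (n : ℕ) : Finite (F2 ⧸ Gamma n) := by
  induction n with
  | zero =>
    have : Subsingleton (F2 ⧸ Gamma 0) := QuotientGroup.subsingleton_quotient_top
    infer_instance
  | succ n ih =>
    refine Finite.of_injective (β := (F2 ⧸ Gamma n) × ((F2 ⧸ Gamma n) × Fin 2 → ZMod 2))
      (fun x => (pr n x.out, Phi (pr n) 1 x.out)) ?_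
    intro x y hxy
    have := pr_succ_eq n 1 x.out y.out (congrArg Prod.fst hxy) (congrArg Prod.snd hxy)
    have h : ∀ q : F2 ⧸ Gamma (n + 1), pr (n + 1) q.out = q := fun q => QuotientGroup.out_eq' q
    rwa [h, h] at this

lemma girth (n : ℕ) (g : F2) (hg : g ≠ 1) (h : g ∈ Gamma n) : n ≤ wordLen g := by
  induction n generalizing g with
  | zero => exact Nat.zero_le _
  | succ n ih =>
    obtain ⟨g', h1, h2, h3⟩ := girth_step (pr n) g hg (Phi_Gamma_succ n g h 1)
    have := ih g' h1 ((pr_eq_one n g').1 h2)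
    omega

lemma qdist_le (n : ℕ) (g h : F2) : qdist n (pr n g) (pr n (g * h)) ≤ wordLen h :=
  Nat.sInf_le ⟨g, g * h, rfl, rfl, by rw [inv_mul_cancel_left]⟩

lemma exists_qdist (n : ℕ) (x y : F2 ⧸ Gamma n) :
    ∃ h : F2, y = x * pr n h ∧ wordLen h = qdist n x y := by
  have hne : {k : ℕ | ∃ a b : F2, QuotientGroup.mk a = x ∧ QuotientGroup.mk b = y ∧
    wordLen (a⁻¹ * b) = k}.Nonempty :=
    ⟨_, x.out, y.out, QuotientGroup.out_eq' x, QuotientGroup.out_eq' y, rfl⟩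
  obtain ⟨a, b, rfl, rfl, h⟩ := Nat.sInf_mem hne
  refine ⟨a⁻¹ * b, ?_, h⟩
  change pr n b = pr n a * pr n (a⁻¹ * b)
  rw [← map_mul, mul_inv_cancel_left]

section Embedding

lemma coarse_of {X H : Type} [NormedAddCommGroup H] (d : X → X → ℝ) (f : X → H)
    (h1 : ∀ R : ℝ, ∃ S : ℝ, ∀ x y, d x y ≤ R → ‖f x - f y‖ ≤ S)
    (h2 : ∀ S : ℝ, ∃ R : ℝ, ∀ x y, ‖f x - f y‖ ≤ S → d x y ≤ R) : IsCoarseEmbedding d f := by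
  intro x y
  constructor
  · intro h
    refine Filter.tendsto_atTop.2 fun b => ?_
    obtain ⟨R, hR⟩ := h2 b
    filter_upwards [h.eventually_gt_atTop R] with k hk
    by_contra hlt
    exact absurd (hR _ _ (not_le.mp hlt).le) (not_le.mpr hk)
  · intro h
    refine Filter.tendsto_atTop.2 fun b => ?_
    obtain ⟨R, hR⟩ := h1 b
    filter_upwards [h.eventually_gt_atTop R] with k hk
    by_contra hlt
    exact absurd (hR _ _ (not_le.mp hlt).le) (not_le.mpr hk)

noncomputable instance Q_fintype (n : ℕ) : Fintype (F2 ⧸ Gamma n) := Fintype.ofFinite _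

lemma box_finite (N : ℕ) : {p : BoxSpace | p.1 ≤ N}.Finite := by
  have : {p : BoxSpace | p.1 ≤ N} ⊆ Set.range
      (fun z : (Σ k : Fin (N + 1), F2 ⧸ Gamma k) => (⟨z.1, z.2⟩ : BoxSpace)) := by
    rintro ⟨n, x⟩ hn
    exact ⟨⟨⟨n, Nat.lt_succ_of_le hn⟩, x⟩, rfl⟩
  exact (Set.finite_range _).subset this

lemma box_bound (N : ℕ) (F : BoxSpace → BoxSpace → ℝ) :
    ∃ S : ℝ, ∀ p q : BoxSpace, p.1 ≤ N → q.1 ≤ N → F p q ≤ S := by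
  have hf := ((box_finite N).prod (box_finite N)).image (fun z => F z.1 z.2)
  obtain ⟨S, hS⟩ := hf.bddAbove
  exact ⟨S, fun p q hp hq => hS ⟨(p, q), ⟨hp, hq⟩, rfl⟩⟩

lemma boxDist_same (n : ℕ) (x y : F2 ⧸ Gamma n) :
    boxDist (⟨n, x⟩ : BoxSpace) (⟨n, y⟩ : BoxSpace) = qdist n x y := by
  simp [boxDist]

lemma boxDist_ne (p q : BoxSpace) (h : p.1 ≠ q.1) : p.1 + q.1 ≤ boxDist p q := by
  rw [boxDist, dif_neg h]; omega

/-- The vector attached to a point of `X_{n+1}` by the walls. -/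
noncomputable def vec (n : ℕ) (x : F2 ⧸ Gamma (n + 1)) :
    EuclideanSpace ℝ ((F2 ⧸ Gamma n) × Fin 2) :=
  WithLp.toLp 2 (fun e => ((Phi (pr n) 1 x.out e).val : ℝ))

lemma out_pr (n : ℕ) (q : F2 ⧸ Gamma n) : pr n q.out = q := QuotientGroup.out_eq' q

lemma vec_dist (n : ℕ) (x : F2 ⧸ Gamma (n + 1)) (h : F2) :
    ‖vec n x - vec n (x * pr (n + 1) h)‖ ^ 2 = wt (Phi (pr n) (pr n x.out) h) := by
  classical
  have h1 : Phi (pr n) 1 (x * pr (n + 1) h).out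
      = Phi (pr n) 1 x.out + Phi (pr n) (pr n x.out) h := by
    rw [Phi_congr n 1 _ (x.out * h) (by rw [out_pr, map_mul, out_pr]), Phi_mul, one_mul]
  rw [EuclideanSpace.norm_sq_eq, wt, Set.ncard_eq_toFinset_card', Finset.card_eq_sum_ones,
    Set.toFinset_ofPred, Finset.sum_filter, Nat.cast_sum]
  refine Finset.sum_congr rfl fun e _ => ?_
  simp only [vec, h1, PiLp.sub_apply, Pi.add_apply]
  generalize Phi (pr n) 1 x.out e = a
  generalize Phi (pr n) (pr n x.out) h e = b
  have key : ∀ a b : ZMod 2, ((a.val : ℤ) - ((a + b).val : ℤ)) ^ 2 = if b ≠ 0 then 1 else 0 := by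
    decide
  rw [Real.norm_eq_abs, sq_abs]
  have := key a b
  have h2 := congrArg (Int.cast : ℤ → ℝ) this
  push_cast at h2 ⊢
  exact h2

/-- The Hilbert space. -/
abbrev HH : Type :=
  WithLp 2 (ℝ × lp (fun n : ℕ => EuclideanSpace ℝ ((F2 ⧸ Gamma n) × Fin 2)) 2)

/-- The embedding. -/
noncomputable def FF : BoxSpace → HH
  | ⟨0, _⟩ => WithLp.toLp 2 (0, 0)
  | ⟨n + 1, x⟩ => WithLp.toLp 2 (((n : ℝ) + 1) ^ 2, lp.single 2 n (vec n x))

lemma FF_fst (p : BoxSpace) : (FF p).fst = (p.1 : ℝ) ^ 2 := by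
  obtain ⟨n, x⟩ := p
  cases n <;> simp [FF]

lemma FF_succ (n : ℕ) (x : F2 ⧸ Gamma (n + 1)) :
    FF ⟨n + 1, x⟩ = WithLp.toLp 2 (((n : ℝ) + 1) ^ 2, lp.single 2 n (vec n x)) := rfl

lemma FF_dist (n : ℕ) (x : F2 ⧸ Gamma (n + 1)) (h : F2) :
    ‖FF ⟨n + 1, x⟩ - FF ⟨n + 1, x * pr (n + 1) h⟩‖ ^ 2 = wt (Phi (pr n) (pr n x.out) h) := by
  rw [← vec_dist, FF_succ, FF_succ, ← WithLp.toLp_sub, Prod.mk_sub_mk, sub_self, ← lp.single_sub,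
    WithLp.prod_norm_sq_eq_of_L2]
  simp only [WithLp.toLp_fst, WithLp.toLp_snd]
  rw [norm_zero, lp.norm_single (by norm_num)]
  ring

lemma FF_lower (p q : BoxSpace) (h : p.1 ≠ q.1) : ((p.1 + q.1 : ℕ) : ℝ) ≤ ‖FF p - FF q‖ := by
  refine le_trans ?_ (WithLp.norm_fst_le _ (FF p - FF q))
  rw [WithLp.sub_fst, FF_fst, FF_fst, Real.norm_eq_abs]
  generalize p.1 = a at *
  generalize q.1 = b at *
  rw [show (a : ℝ) ^ 2 - (b : ℝ) ^ 2 = (a - b) * (a + b) by ring, abs_mul]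
  have h1 : (1 : ℝ) ≤ |(a : ℝ) - b| := by
    have : (1 : ℤ) ≤ |(a : ℤ) - b| := Int.one_le_abs (by omega)
    exact_mod_cast this
  have h2 : |(a : ℝ) + b| = a + b := abs_of_nonneg (by positivity)
  rw [h2]; push_cast
  nlinarith [(by positivity : (0 : ℝ) ≤ (a : ℝ) + b)]

lemma FF_coarse : IsCoarseEmbedding (fun p q : BoxSpace => (boxDist p q : ℝ)) FF := by
  apply coarse_of
  · intro R
    obtain ⟨N, hN⟩ := exists_nat_ge R
    obtain ⟨S, hS⟩ := box_bound N (fun p q => ‖FF p - FF q‖)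
    refine ⟨max S (N + 1), fun p q hpq => ?_⟩
    have hpq : boxDist p q ≤ N := by exact_mod_cast hpq.trans hN
    by_cases hne : p.1 = q.1
    · obtain ⟨n, x⟩ := p
      obtain ⟨m, y⟩ := q
      obtain rfl : n = m := hne
      rcases n with _ | n
      · exact (hS _ _ (Nat.zero_le _) (Nat.zero_le _)).trans (le_max_left _ _)
      · refine le_trans ?_ (le_max_right _ _)
        rw [boxDist_same] at hpq
        obtain ⟨h, rfl, hh⟩ := exists_qdist _ x y
        have h1 := FF_dist n x h
        have h2 := wt_Phi_le (pr n) (pr n x.out) h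
        have h3 : (wt (Phi (pr n) (pr n x.out) h) : ℝ) ≤ N := by exact_mod_cast by omega
        refine abs_le_of_sq_le_sq' ?_ (by positivity) |>.2
        rw [h1]; nlinarith [(Nat.cast_nonneg N : (0 : ℝ) ≤ N)]
    · have := boxDist_ne p q hne
      exact (hS _ _ (by omega) (by omega)).trans (le_max_left _ _)
  · intro S
    obtain ⟨N, hN⟩ := exists_nat_ge (max S (S ^ 2))
    obtain ⟨R, hR⟩ := box_bound (N + 1) (fun p q => (boxDist p q : ℝ))
    refine ⟨max R N, fun p q hpq => ?_⟩
    by_cases hne : p.1 = q.1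
    · obtain ⟨n, x⟩ := p
      obtain ⟨m, y⟩ := q
      obtain rfl : n = m := hne
      rcases n with _ | n
      · exact (hR _ _ (Nat.zero_le _) (Nat.zero_le _)).trans (le_max_left _ _)
      · by_cases hn : n ≤ N
        · exact (hR _ _ (Nat.succ_le_succ hn) (Nat.succ_le_succ hn)).trans (le_max_left _ _)
        · refine le_trans ?_ (le_max_right _ _)
          rw [boxDist_same]
          obtain ⟨h, rfl, hh⟩ := exists_qdist _ x y
          have h1 := FF_dist n x h
          have h2 : (wt (Phi (pr n) (pr n x.out) h) : ℝ) ≤ N := by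
            rw [← h1]
            refine le_trans ?_ ((le_max_right _ _).trans hN)
            exact pow_le_pow_left₀ (norm_nonneg _) hpq 2
          have h3 : wt (Phi (pr n) (pr n x.out) h) ≤ N := by exact_mod_cast h2
          obtain ⟨h', a1, a2, a3⟩ := wall_lower (pr n) n
            (fun g hg hg1 => girth n g hg ((pr_eq_one n g).1 hg1)) (pr n x.out) h (by omega)
          rw [← pr_succ_eq n _ _ _ a1 a2]
          have h4 := qdist_le (n + 1) x.out h'
          rw [map_mul, out_pr] at h4
          exact_mod_cast by omega
    · have h1 := FF_lower p q hne
      have h2 : p.1 + q.1 ≤ N := by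
        exact_mod_cast h1.trans (hpq.trans ((le_max_left _ _).trans hN))
      exact (hR _ _ (by omega) (by omega)).trans (le_max_left _ _)

end Embedding

section NotA

lemma ratio_le {β : Type} [DecidableEq β] (s t : Finset β) (hs : s.Nonempty) (ht : t.Nonempty)
    (h : ((symmDiff s t).card : ℝ) < 1 / 8 * ((s ∩ t).card : ℝ)) (B : β → Prop)
    [DecidablePred B] :
    ((s.filter B).card : ℝ) / s.card ≤ ((t.filter B).card : ℝ) / t.card + 1 / 4 := by
  have h1 : (s.filter B).card ≤ (t.filter B).card + (symmDiff s t).card := by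
    refine le_trans (Finset.card_le_card ?_) (Finset.card_union_le _ _)
    intro p hp
    rw [Finset.mem_filter] at hp
    rw [Finset.mem_union, Finset.mem_filter, Finset.mem_symmDiff]
    tauto
  have h2 : t.card ≤ s.card + (symmDiff s t).card := by
    refine le_trans (Finset.card_le_card ?_) (Finset.card_union_le _ _)
    intro p hp
    rw [Finset.mem_union, Finset.mem_symmDiff]
    tauto
  have h3 : (s ∩ t).card ≤ s.card := Finset.card_le_card Finset.inter_subset_left
  have h4 : (t.filter B).card ≤ t.card := Finset.card_filter_le _ _
  have hσ : (0 : ℝ) < s.card := by exact_mod_cast hs.card_pos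
  have hτ : (0 : ℝ) < t.card := by exact_mod_cast ht.card_pos
  have h1' : ((s.filter B).card : ℝ) ≤ (t.filter B).card + (symmDiff s t).card := by
    exact_mod_cast h1
  have h2' : (t.card : ℝ) ≤ s.card + (symmDiff s t).card := by exact_mod_cast h2
  have h3' : ((s ∩ t).card : ℝ) ≤ s.card := by exact_mod_cast h3
  have h4' : ((t.filter B).card : ℝ) ≤ t.card := by exact_mod_cast h4
  have h5' : (0 : ℝ) ≤ ((t.filter B).card : ℝ) := Nat.cast_nonneg _
  generalize ((s.filter B).card : ℝ) = a at *
  generalize ((t.filter B).card : ℝ) = b at *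
  generalize (s.card : ℝ) = σ at *
  generalize (t.card : ℝ) = τ at *
  have hb : b / τ ≤ 1 := (div_le_one hτ).2 h4'
  have hr : 0 ≤ b / τ := div_nonneg h5' hτ.le
  have hb2 : b = b / τ * τ := by field_simp
  generalize b / τ = r at *
  rw [div_le_iff₀ hσ]
  nlinarith

lemma head_cons (ℓ : Fin 2 × Bool) (g : F2) (h : g.toWord.head? ≠ some (ℓ.1, !ℓ.2)) :
    (FreeGroup.mk [ℓ] * g).toWord = ℓ :: g.toWord := by
  have hr : FreeGroup.IsReduced g.toWord := isReduced_toWord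
  conv_lhs => rw [← mk_toWord (x := g), FreeGroup.mul_mk, toWord_mk]
  apply FreeGroup.IsReduced.reduce_eq
  generalize g.toWord = W at *
  rcases W with _ | ⟨w, W⟩
  · exact FreeGroup.IsReduced.singleton
  · refine FreeGroup.isReduced_cons_cons.2 ⟨?_, hr⟩
    intro e
    by_contra hne
    apply h
    obtain ⟨i, b⟩ := ℓ
    obtain ⟨j, b'⟩ := w
    simp only at e hne
    subst e
    cases b <;> cases b' <;> simp_all

lemma not_propA : ¬ HasPropertyA (fun p q : BoxSpace => (boxDist p q : ℝ)) := by
  classical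
  intro hA
  obtain ⟨A, S, hS, hne, hsd, hball⟩ := hA (1 / 8) (by norm_num) 1 one_pos
  obtain ⟨m, hm⟩ := exists_nat_ge S
  obtain ⟨n, hn⟩ : ∃ n, n = 2 * m + 3 := ⟨_, rfl⟩
  have f1 : ∀ (x : F2 ⧸ Gamma n), ∀ p ∈ A ⟨n, x⟩, ∃ g : F2, wordLen g ≤ m ∧
      p.1 = ⟨n, x * pr n g⟩ := by
    rintro x ⟨⟨k, y⟩, j⟩ hp
    have h1 : boxDist ⟨n, x⟩ ⟨k, y⟩ ≤ m := by
      have h0 : ((boxDist ⟨n, x⟩ ⟨k, y⟩ : ℕ) : ℝ) ≤ S := hball _ _ hp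
      exact_mod_cast h0.trans hm
    by_cases hk : n = k
    · subst hk
      rw [boxDist_same] at h1
      obtain ⟨h, rfl, hh⟩ := exists_qdist _ x y
      exact ⟨h, by omega, rfl⟩
    · have : n + k ≤ boxDist ⟨n, x⟩ ⟨k, y⟩ := boxDist_ne ⟨n, x⟩ ⟨k, y⟩ hk
      omega
  let U : Fin 2 × Bool → Set (F2 ⧸ Gamma n) := fun ℓ =>
    {q | ∃ g : F2, g.toWord.head? = some ℓ ∧ wordLen g ≤ m + 1 ∧ pr n g = q}
  have hU : ∀ ℓ ℓ' q, q ∈ U ℓ → q ∈ U ℓ' → ℓ = ℓ' := by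
    rintro ℓ ℓ' q ⟨g, h1, h2, h3⟩ ⟨g', h1', h2', h3'⟩
    have h4 : g⁻¹ * g' ∈ Gamma n := (mk_eq_iff n g g').1 (h3.trans h3'.symm)
    have h5 : g = g' := by
      by_contra hgg
      have h6 := girth n _ (fun h => hgg (inv_mul_eq_one.mp h)) h4
      have h7 := wordLen_mul g⁻¹ g'
      rw [wordLen_inv] at h7
      omega
    subst h5
    rw [h1] at h1'
    exact Option.some.inj h1'
  let P : (F2 ⧸ Gamma n) → Fin 2 × Bool → ℝ := fun x ℓ =>
    (((A ⟨n, x⟩).filter (fun p => ∃ z ∈ U ℓ, p.1 = ⟨n, x * z⟩)).card : ℝ) / (A ⟨n, x⟩).card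
  have hpos : ∀ x : F2 ⧸ Gamma n, (0 : ℝ) < (A ⟨n, x⟩).card := fun x => by
    exact_mod_cast (hne ⟨n, x⟩).card_pos
  have inj : ∀ x y : F2 ⧸ Gamma n, (⟨n, x⟩ : BoxSpace) = ⟨n, y⟩ → x = y := fun x y h =>
    eq_of_heq (Sigma.mk.inj h).2
  have f2 : ∀ x, ∑ ℓ, P x ℓ ≤ 1 := by
    intro x
    simp only [P]
    rw [← Finset.sum_div, div_le_one (hpos x), ← Nat.cast_sum, Nat.cast_le,
      ← Finset.card_biUnion]
    · refine Finset.card_le_card ?_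
      intro p hp
      rw [Finset.mem_biUnion] at hp
      obtain ⟨ℓ, _, h⟩ := hp
      exact (Finset.mem_filter.1 h).1
    · intro ℓ _ ℓ' _ hℓ
      refine Finset.disjoint_left.2 ?_
      intro p hp hp'
      obtain ⟨_, z, hz, e⟩ := Finset.mem_filter.1 hp
      obtain ⟨_, z', hz', e'⟩ := Finset.mem_filter.1 hp'
      have := mul_left_cancel (inj _ _ (e.symm.trans e'))
      subst this
      exact hℓ (hU _ _ _ hz hz')
  have f3 : ∀ (i : Fin 2) (x : F2 ⧸ Gamma n),
      1 ≤ P x (i, false) + P (x * (pr n (of i))⁻¹) (i, true) + 1 / 4 := by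
    intro i x
    have hd : ((boxDist ⟨n, x⟩ ⟨n, x * (pr n (of i))⁻¹⟩ : ℕ) : ℝ) ≤ 1 := by
      rw [boxDist_same]
      have := qdist_le n x.out (of i)⁻¹
      rw [map_mul, out_pr, map_inv, wordLen_inv, wordLen_of] at this
      exact_mod_cast this
    have hr := @ratio_le _ (Classical.decEq _) _ _ (hne ⟨n, x⟩) (hne ⟨n, x * (pr n (of i))⁻¹⟩) (hsd _ _ hd)
      (fun p => ∃ z ∈ U (i, true), p.1 = ⟨n, x * (pr n (of i))⁻¹ * z⟩) _
    have hcov : (1 : ℝ) ≤ P x (i, false) + (((A ⟨n, x⟩).filter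
        (fun p => ∃ z ∈ U (i, true), p.1 = ⟨n, x * (pr n (of i))⁻¹ * z⟩)).card : ℝ)
          / (A ⟨n, x⟩).card := by
      simp only [P]
      rw [← add_div, one_le_div (hpos x), ← Nat.cast_add, Nat.cast_le]
      refine le_trans (Finset.card_le_card ?_) (Finset.card_union_le _ _)
      intro p hp
      obtain ⟨g, hg, hpg⟩ := f1 x p hp
      rw [Finset.mem_union, Finset.mem_filter, Finset.mem_filter]
      by_cases hh : g.toWord.head? = some (i, false)
      · exact Or.inl ⟨hp, pr n g, ⟨g, hh, by omega, rfl⟩, hpg⟩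
      · refine Or.inr ⟨hp, pr n (of i * g), ⟨of i * g, ?_, ?_, rfl⟩, ?_⟩
        · have := head_cons (i, true) g (by simpa using hh)
          rw [mk_true] at this
          rw [this]; rfl
        · have := wordLen_mul (of i) g
          rw [wordLen_of] at this
          omega
        · rw [hpg, map_mul, mul_assoc, inv_mul_cancel_left]
    have : P (x * (pr n (of i))⁻¹) (i, true) = (((A ⟨n, x * (pr n (of i))⁻¹⟩).filter
        (fun p => ∃ z ∈ U (i, true), p.1 = ⟨n, x * (pr n (of i))⁻¹ * z⟩)).card : ℝ)
          / (A ⟨n, x * (pr n (of i))⁻¹⟩).card := rfl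
    linarith
  have f4 : ∀ i : Fin 2, (Fintype.card (F2 ⧸ Gamma n) : ℝ) ≤
      ∑ x, P x (i, false) + ∑ x, P x (i, true) + Fintype.card (F2 ⧸ Gamma n) * (1 / 4) := by
    intro i
    have h1 := Finset.sum_le_sum (s := Finset.univ) (fun x _ => f3 i x)
    rw [Finset.sum_add_distrib, Finset.sum_add_distrib] at h1
    have h2 : ∑ x, P (x * (pr n (of i))⁻¹) (i, true) = ∑ x, P x (i, true) :=
      Equiv.sum_comp (Equiv.mulRight (pr n (of i))⁻¹) (fun x => P x (i, true))
    rw [h2] at h1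
    simpa using h1
  have f5 := Finset.sum_le_sum (s := Finset.univ) (fun x _ => f2 x)
  simp only [Fintype.sum_prod_type, Fin.sum_univ_two, Fintype.sum_bool,
    Finset.sum_add_distrib, Finset.sum_const, Finset.card_univ, nsmul_eq_mul, mul_one] at f5
  have h0 := f4 0
  have h1 := f4 1
  have hc : (0 : ℝ) < Fintype.card (F2 ⧸ Gamma n) := by exact_mod_cast Fintype.card_pos
  linarith

end NotA

end BoxAux

/-- The box space `X = ⊔ X_n` of `F₂` associated with the iterated square subgroups
`Γ_n` coarsely embeds into a Hilbert space, but does not have Property A. -/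
theorem boxSpace_coarselyEmbeddable_not_propertyA :
    CoarselyEmbeddableIntoHilbert (fun p q : BoxSpace => (boxDist p q : ℝ)) ∧
    ¬ HasPropertyA (fun p q : BoxSpace => (boxDist p q : ℝ)) := by
  exact ⟨⟨BoxAux.HH, inferInstance, inferInstance, inferInstance, BoxAux.FF, BoxAux.FF_coarse⟩,
    BoxAux.not_propA⟩
end

section
/- Let Γ₀ = F₂, Γ_n = Γ_{n−1}^{(2)} for n ≥ 1, let X_n be the Cayley graph of F₂/Γ_n with respect to the images of the two canonical generators, and let (X, d_X) be the coarse disjoint union of the X_n (each X_n with its graph metric, and d_X(X_n, X_m) = diam(X_n) + diam(X_m) + n + m for n ≠ m). Then the metric space (X, d_X) does not have Property A. -/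
instance sqNormal_characteristic (Γ : Type) [Group Γ] : (sqNormal Γ).Characteristic := by
  rw [Subgroup.characteristic_iff_le_comap]
  intro φ
  have : (Subgroup.comap φ.toMonoidHom (sqNormal Γ)).Normal :=
    Subgroup.Normal.comap Subgroup.normalClosure_normal _
  refine Subgroup.normalClosure_le_normal ?_
  rintro x ⟨g, rfl⟩
  exact Subgroup.subset_normalClosure ⟨φ g, by simp⟩

instance sqNormal_normal (Γ : Type) [Group Γ] : (sqNormal Γ).Normal :=
  Subgroup.normalClosure_normal

instance Gamma_normal : ∀ n, (Gamma n).Normal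
  | 0 => by rw [Gamma]; infer_instance
  | n + 1 => by
    have := Gamma_normal n
    rw [Gamma]; infer_instance

lemma Gamma_succ_le (n : ℕ) : Gamma (n + 1) ≤ Gamma n := by
  rw [Gamma]
  exact Subgroup.map_subtype_le _

lemma quot_sqNormal_finite (Γ : Type) [Group Γ] [Group.FG Γ] : Finite (Γ ⧸ sqNormal Γ) := by
  have hsq : ∀ a : Γ ⧸ sqNormal Γ, a * a = 1 := by
    intro a
    obtain ⟨g, rfl⟩ := QuotientGroup.mk_surjective a
    rw [← QuotientGroup.mk_mul, QuotientGroup.eq_one_iff]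
    exact Subgroup.subset_normalClosure ⟨g, by rw [sq]⟩
  have hinv : ∀ a : Γ ⧸ sqNormal Γ, a⁻¹ = a := fun a => inv_eq_of_mul_eq_one_left (hsq a)
  have hc : ∀ a b : Γ ⧸ sqNormal Γ, a * b = b * a := by
    intro a b
    rw [← hinv (a * b), mul_inv_rev, hinv, hinv]
  let _ : CommGroup (Γ ⧸ sqNormal Γ) := { (inferInstance : Group (Γ ⧸ sqNormal Γ)) with mul_comm := hc }
  apply CommGroup.finite_of_fg_isMulTorsion
  intro a
  rw [isOfFinOrder_iff_pow_eq_one]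
  exact ⟨2, by norm_num, by rw [sq]; exact hsq a⟩

instance Gamma_finiteIndex : ∀ n, (Gamma n).FiniteIndex
  | 0 => by rw [Gamma]; infer_instance
  | n + 1 => by
    have h1 := Gamma_finiteIndex n
    have h2 := quot_sqNormal_finite (Gamma n)
    have h3 : (sqNormal (Gamma n)).FiniteIndex := Subgroup.finiteIndex_of_finite_quotient
    constructor
    rw [← Subgroup.relIndex_mul_index (Gamma_succ_le n)]
    refine mul_ne_zero ?_ h1.index_ne_zero
    have : (Gamma (n+1)).subgroupOf (Gamma n) = sqNormal (Gamma n) := by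
      rw [Gamma, Subgroup.subgroupOf, Subgroup.comap_map_eq_self_of_injective]
      exact Subtype.val_injective
    rw [Subgroup.relIndex, this]
    exact h3.index_ne_zero

/-- The permutation of the twisted double cover of a left Cayley graph induced by a generator. -/
def twist {Q : Type} [Group Q] (x : Q) (c : Q → ZMod 2) : Equiv.Perm (Q × ZMod 2) where
  toFun p := (x * p.1, p.2 + c p.1)
  invFun p := (x⁻¹ * p.1, p.2 - c (x⁻¹ * p.1))
  left_inv p := by ext <;> simp
  right_inv p := by ext <;> simp

open Classical in
/-- The homomorphism to permutations of the double cover twisted along one edge. -/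
noncomputable def twistHom (n : ℕ) (i₀ : Fin 2) (e₀ : F2 ⧸ Gamma n) :
    F2 →* Equiv.Perm ((F2 ⧸ Gamma n) × ZMod 2) :=
  FreeGroup.lift fun i => twist (QuotientGroup.mk (FreeGroup.of i))
    (fun v => if i = i₀ ∧ v = e₀ then 1 else 0)

lemma twistHom_fst (n : ℕ) (i₀ : Fin 2) (e₀ : F2 ⧸ Gamma n) (g : F2) :
    ∀ p, (twistHom n i₀ e₀ g p).1 = QuotientGroup.mk g * p.1 := by
  induction g using FreeGroup.induction_on with
  | C1 => intro p; simp
  | of i => intro p; simp [twistHom, twist]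
  | inv_of i _ => intro p; simp [twistHom, twist, Equiv.Perm.inv_def]
  | mul a b ha hb => intro p; simp [ha, hb, mul_assoc]

lemma twistHom_snd (n : ℕ) (i₀ : Fin 2) (e₀ : F2 ⧸ Gamma n) (g : F2) :
    ∀ v t, (twistHom n i₀ e₀ g (v, t)).2 = t + (twistHom n i₀ e₀ g (v, 0)).2 := by
  induction g using FreeGroup.induction_on with
  | C1 => intro v t; simp
  | of i => intro v t; simp [twistHom, twist]
  | inv_of i _ => intro v t; simp [twistHom, twist, Equiv.Perm.inv_def, sub_eq_add_neg]
  | mul a b ha hb =>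
    intro v t
    have h1 : ∀ p, (twistHom n i₀ e₀ (a * b) p) = twistHom n i₀ e₀ a
      ((twistHom n i₀ e₀ b p).1, (twistHom n i₀ e₀ b p).2) := by intro p; simp
    rw [h1, h1, ha, twistHom_fst, hb, ha _ (Prod.snd _), twistHom_fst, add_assoc]

lemma twistHom_succ (n : ℕ) (i₀ : Fin 2) (e₀ : F2 ⧸ Gamma n) (g : F2) (hg : g ∈ Gamma (n + 1)) :
    twistHom n i₀ e₀ g = 1 := by
  rw [Gamma] at hg
  obtain ⟨γ, hγ, rfl⟩ := hg
  have : sqNormal (Gamma n) ≤ ((twistHom n i₀ e₀).comp (Gamma n).subtype).ker := by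
    refine Subgroup.normalClosure_le_normal ?_
    rintro x ⟨⟨h, hh⟩, rfl⟩
    change twistHom n i₀ e₀ (h ^ 2) = 1
    have h1 : ∀ p, (twistHom n i₀ e₀ h p).1 = p.1 := by
      intro p
      rw [twistHom_fst, (QuotientGroup.eq_one_iff h).2 hh, one_mul]
    rw [sq, map_mul]
    ext ⟨v, t⟩
    · simp [h1]
    · have : twistHom n i₀ e₀ h (v, t) = (v, (twistHom n i₀ e₀ h (v, t)).2) :=
        Prod.ext (h1 _) rfl
      rw [Equiv.Perm.mul_apply, this, twistHom_snd, twistHom_snd n i₀ e₀ h v t, add_assoc,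
        CharTwo.add_self_eq_zero]
      simp
  exact this hγ

/-- The base vertex of the oriented edge crossed by the letter `s` starting at `v`. -/
def ebase {n : ℕ} (s : Fin 2 × Bool) (v : F2 ⧸ Gamma n) : F2 ⧸ Gamma n :=
  if s.2 then v else (QuotientGroup.mk (FreeGroup.of s.1))⁻¹ * v

open Classical in
lemma twistHom_letter (n : ℕ) (i₀ : Fin 2) (e₀ : F2 ⧸ Gamma n) (s : Fin 2 × Bool)
    (v : F2 ⧸ Gamma n) (t : ZMod 2) :
    twistHom n i₀ e₀ (FreeGroup.mk [s]) (v, t) =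
      (QuotientGroup.mk (FreeGroup.mk [s]) * v,
        t + if s.1 = i₀ ∧ ebase s v = e₀ then 1 else 0) := by
  refine Prod.ext (twistHom_fst _ _ _ _ _) ?_
  obtain ⟨i, b⟩ := s
  cases b
  · have : (FreeGroup.mk [(i, false)] : F2) = (FreeGroup.of i)⁻¹ := rfl
    rw [this]
    simp [twistHom, twist, Equiv.Perm.inv_def, ebase, CharTwo.sub_eq_add]
  · have : (FreeGroup.mk [(i, true)] : F2) = (FreeGroup.of i) := rfl
    rw [this]
    simp [twistHom, twist, ebase]

lemma mk_cons (s : Fin 2 × Bool) (L : List (Fin 2 × Bool)) :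
    (FreeGroup.mk (s :: L) : F2) = FreeGroup.mk [s] * FreeGroup.mk L := by
  simp

lemma suffix_inj {n : ℕ} (hn : ∀ g ∈ Gamma n, wordLen g ≤ n → g = 1)
    {w u v : List (Fin 2 × Bool)} (hw : FreeGroup.IsReduced w) (hl : w.length ≤ n)
    (hu : u <:+ w) (hv : v <:+ u)
    (h : (QuotientGroup.mk (FreeGroup.mk u) : F2 ⧸ Gamma n) = QuotientGroup.mk (FreeGroup.mk v)) :
    u = v := by
  obtain ⟨p, rfl⟩ := hv
  have hp : FreeGroup.IsReduced p := hw.infix ((List.prefix_append p v).isInfix.trans hu.isInfix)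
  have h2 : (FreeGroup.mk p : F2) ∈ Gamma n := by
    rw [← FreeGroup.mul_mk, QuotientGroup.mk_mul] at h
    rw [← QuotientGroup.eq_one_iff]
    exact mul_eq_right.1 h
  have h3 := hn _ h2 (by
    have := hu.length_le
    rw [wordLen, FreeGroup.toWord_mk, hp.reduce_eq]
    simp at this; omega)
  have h4 : p = [] := by
    have := congrArg FreeGroup.toWord h3
    rwa [FreeGroup.toWord_mk, hp.reduce_eq, FreeGroup.toWord_one] at this
  simp [h4]

lemma Gamma_inj : ∀ n, ∀ g ∈ Gamma n, wordLen g ≤ n → g = 1 := by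
  intro n
  induction n with
  | zero =>
    intro g _ h
    exact FreeGroup.norm_eq_zero.1 (Nat.le_zero.1 h)
  | succ n ih =>
    intro g hg hl
    rcases hgw : FreeGroup.toWord g with _ | ⟨s, w⟩
    · exact FreeGroup.toWord_eq_nil_iff.1 hgw
    exfalso
    have hred : FreeGroup.IsReduced (s :: w) := hgw ▸ FreeGroup.isReduced_toWord
    have hwred : FreeGroup.IsReduced w := hred.infix (List.suffix_cons s w).isInfix
    have hwl : w.length ≤ n := by
      rw [wordLen, hgw] at hl; simpa using hl
    have hgm : g = FreeGroup.mk (s :: w) := by rw [← hgw, FreeGroup.mk_toWord]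
    have h1 := twistHom_succ n s.1 (ebase s (QuotientGroup.mk (FreeGroup.mk w))) g hg
    have key : ∀ L, L <:+ w →
        twistHom n s.1 (ebase s (QuotientGroup.mk (FreeGroup.mk w))) (FreeGroup.mk L) (1, 0) =
          (QuotientGroup.mk (FreeGroup.mk L), 0) := by
      intro L
      induction L with
      | nil => intro _; rw [← FreeGroup.one_eq_mk]; simp
      | cons a L ihL =>
        intro hL
        have hL' : L <:+ w := (List.suffix_cons a L).trans hL
        rw [mk_cons, map_mul, Equiv.Perm.mul_apply, ihL hL', twistHom_letter, if_neg]
        · rw [← QuotientGroup.mk_mul, add_zero]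
        rintro ⟨ha, hb⟩
        obtain ⟨i, b⟩ := s
        obtain ⟨j, c⟩ := a
        simp only at ha
        subst ha
        by_cases hbc : b = c
        · have : (QuotientGroup.mk (FreeGroup.mk w) : F2 ⧸ Gamma n)
            = QuotientGroup.mk (FreeGroup.mk L) := by
            subst hbc
            cases b
            · simpa [ebase] using hb.symm
            · simpa [ebase] using hb.symm
          have := suffix_inj ih hwred hwl (List.suffix_refl w) hL' this
          subst this
          have := hL.length_le
          simp at this
        · have : (QuotientGroup.mk (FreeGroup.mk w) : F2 ⧸ Gamma n)
            = QuotientGroup.mk (FreeGroup.mk ((j, c) :: L)) := by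
            rw [mk_cons, QuotientGroup.mk_mul]
            cases b <;> cases c
            · simp at hbc
            · have h2 : (FreeGroup.mk [(j, true)] : F2) = (FreeGroup.of j) := rfl
              rw [h2]
              simp only [ebase] at hb
              simp at hb
              rw [hb]; simp
            · have h2 : (FreeGroup.mk [(j, false)] : F2) = (FreeGroup.of j)⁻¹ := rfl
              rw [h2]
              simp only [ebase] at hb
              simp at hb
              rw [← hb]; simp
            · simp at hbc
          have := suffix_inj ih hwred hwl (List.suffix_refl w) hL this
          subst this
          rw [FreeGroup.isReduced_cons_cons] at hred
          exact hbc (hred.1 rfl)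
    have h2 := congrArg (fun f => (f (1, 0)).2) h1
    rw [hgm, mk_cons, map_mul, Equiv.Perm.mul_apply, key w (List.suffix_refl w),
      twistHom_letter, if_pos ⟨rfl, rfl⟩] at h2
    simp at h2

/-- `p` lies over a point `x * g` with `g` a short element whose reduced word starts with `s`. -/
def startsWith (n T : ℕ) (s : Fin 2 × Bool) (x : F2 ⧸ Gamma n) (p : BoxSpace × ℕ) : Prop :=
  ∃ g : F2, p.1 = ⟨n, x * QuotientGroup.mk g⟩ ∧ wordLen g ≤ T + 1 ∧
    (FreeGroup.toWord g).head? = some s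

lemma startsWith_unique {n T : ℕ} (hn : 2 * T + 2 ≤ n) {s s' : Fin 2 × Bool} {x : F2 ⧸ Gamma n}
    {p : BoxSpace × ℕ} (h : startsWith n T s x p) (h' : startsWith n T s' x p) : s = s' := by
  obtain ⟨g, h1, h2, h3⟩ := h
  obtain ⟨g', h1', h2', h3'⟩ := h'
  have e : (QuotientGroup.mk g : F2 ⧸ Gamma n) = QuotientGroup.mk g' := by
    have := h1.symm.trans h1'
    have := eq_of_heq (Sigma.mk.inj this).2
    exact mul_left_cancel this
  have h4 := QuotientGroup.eq.1 e
  have h5 : wordLen (g⁻¹ * g') ≤ wordLen g + wordLen g' := by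
    have := FreeGroup.norm_mul_le g⁻¹ g'
    rw [FreeGroup.norm_inv_eq] at this
    exact this
  have h6 := Gamma_inj n _ h4 (by omega)
  have h7 : g = g' := inv_mul_eq_one.1 h6
  subst h7
  exact Option.some.inj (h3.symm.trans h3')

lemma startsWith_cases {n T : ℕ} (i : Fin 2) {x : F2 ⧸ Gamma n} {p : BoxSpace × ℕ} {g : F2}
    (h1 : p.1 = ⟨n, x * QuotientGroup.mk g⟩) (h2 : wordLen g ≤ T) :
    startsWith n T (i, true) x p ∨
      startsWith n T (i, false) (x * QuotientGroup.mk (FreeGroup.of i)) p := by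
  by_cases h : (FreeGroup.toWord g).head? = some (i, true)
  · exact Or.inl ⟨g, h1, by omega, h⟩
  · right
    have hw : FreeGroup.toWord ((FreeGroup.of i)⁻¹ * g) = (i, false) :: FreeGroup.toWord g := by
      have e : (FreeGroup.of i)⁻¹ * g = FreeGroup.mk ((i, false) :: FreeGroup.toWord g) := by
        rw [mk_cons, FreeGroup.mk_toWord]; rfl
      rw [e, FreeGroup.toWord_mk]
      apply FreeGroup.IsReduced.reduce_eq
      have hr : FreeGroup.IsReduced (FreeGroup.toWord g) := FreeGroup.isReduced_toWord
      rcases hg : FreeGroup.toWord g with _ | ⟨⟨j, b⟩, w⟩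
      · simp
      · rw [hg] at hr h
        rw [FreeGroup.isReduced_cons_cons]
        refine ⟨?_, hr⟩
        intro hij
        simp only at hij
        subst hij
        cases b
        · rfl
        · simp at h
    refine ⟨(FreeGroup.of i)⁻¹ * g, ?_, ?_, ?_⟩
    · rw [h1]; simp [mul_assoc]; rfl
    · rw [wordLen, hw]; simpa [wordLen] using h2
    · rw [hw]; rfl

lemma core {n T : ℕ} (hn : 2 * T + 2 ≤ n) [DecidableEq (BoxSpace × ℕ)]
    (A : (F2 ⧸ Gamma n) → Finset (BoxSpace × ℕ)) (hne : ∀ x, (A x).Nonempty)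
    (h1 : ∀ x i, ((symmDiff (A x) (A (x * QuotientGroup.mk (FreeGroup.of i)))).card : ℝ)
      ≤ 1 / 4 * (A x).card)
    (h2 : ∀ x, ∀ p ∈ A x, ∃ g : F2, p.1 = ⟨n, x * QuotientGroup.mk g⟩ ∧ wordLen g ≤ T) :
    False := by
  classical
  have : Finite (F2 ⧸ Gamma n) := inferInstance
  have : Fintype (F2 ⧸ Gamma n) := Fintype.ofFinite _
  let P : Fin 2 × Bool → (F2 ⧸ Gamma n) → Finset (BoxSpace × ℕ) :=
    fun s x => (A x).filter (startsWith n T s x)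
  have hP : ∀ x, ∑ s, (P s x).card ≤ (A x).card := by
    intro x
    rw [← Finset.card_biUnion]
    · apply Finset.card_le_card
      intro p hp
      obtain ⟨s, -, hs⟩ := Finset.mem_biUnion.1 hp
      exact (Finset.mem_filter.1 hs).1
    · intro s _ s' _ hss
      refine Finset.disjoint_left.2 ?_
      intro p hp hp'
      exact hss (startsWith_unique hn (Finset.mem_filter.1 hp).2 (Finset.mem_filter.1 hp').2)
  have hA : ∀ x i, (A x).card ≤ (P (i, true) x).card +
      (P (i, false) (x * QuotientGroup.mk (FreeGroup.of i))).card +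
      (symmDiff (A x) (A (x * QuotientGroup.mk (FreeGroup.of i)))).card := by
    intro x i
    refine le_trans (Finset.card_le_card ?_) ((Finset.card_union_le _ _).trans
      (Nat.add_le_add_right (Finset.card_union_le _ _) _))
    intro p hp
    obtain ⟨g, hg, hg'⟩ := h2 x p hp
    rw [Finset.mem_union, Finset.mem_union, Finset.mem_symmDiff]
    rcases startsWith_cases i hg hg' with h | h
    · exact Or.inl (Or.inl (Finset.mem_filter.2 ⟨hp, h⟩))
    · by_cases hq : p ∈ A (x * QuotientGroup.mk (FreeGroup.of i))
      · exact Or.inl (Or.inr (Finset.mem_filter.2 ⟨hq, h⟩))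
      · exact Or.inr (Or.inl ⟨hp, hq⟩)
  have hS : ∀ i, (∑ x, ((A x).card : ℝ)) ≤ ∑ x, ((P (i, true) x).card : ℝ) +
      ∑ x, ((P (i, false) x).card : ℝ) + 1 / 4 * ∑ x, ((A x).card : ℝ) := by
    intro i
    rw [← Equiv.sum_comp (Equiv.mulRight (QuotientGroup.mk (FreeGroup.of i) : F2 ⧸ Gamma n))
      (fun x => ((P (i, false) x).card : ℝ)), Finset.mul_sum, ← Finset.sum_add_distrib,
      ← Finset.sum_add_distrib]
    apply Finset.sum_le_sum
    intro x _
    have a := h1 x i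
    have b : ((A x).card : ℝ) ≤ (P (i, true) x).card +
      (P (i, false) (x * QuotientGroup.mk (FreeGroup.of i))).card +
      (symmDiff (A x) (A (x * QuotientGroup.mk (FreeGroup.of i)))).card := by
      exact_mod_cast hA x i
    simp only [Equiv.coe_mulRight]
    linarith
  have hT : ∑ s, ∑ x, ((P s x).card : ℝ) ≤ ∑ x, ((A x).card : ℝ) := by
    rw [Finset.sum_comm]
    apply Finset.sum_le_sum
    intro x _
    exact_mod_cast hP x
  have hpos : 0 < ∑ x, ((A x).card : ℝ) :=
    Finset.sum_pos (fun x _ => by exact_mod_cast (hne x).card_pos) ⟨1, Finset.mem_univ _⟩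
  rw [Fintype.sum_prod_type] at hT
  simp only [Fin.sum_univ_two, Fintype.sum_bool] at hT
  have a := hS 0
  have b := hS 1
  linarith

lemma boxDist_same (n : ℕ) (x y : F2 ⧸ Gamma n) :
    boxDist ⟨n, x⟩ ⟨n, y⟩ = qdist n x y := dif_pos rfl

lemma qdist_gen (n : ℕ) (x : F2 ⧸ Gamma n) (i : Fin 2) :
    qdist n x (x * QuotientGroup.mk (FreeGroup.of i)) ≤ 1 := by
  obtain ⟨a, rfl⟩ := QuotientGroup.mk_surjective x
  refine Nat.sInf_le ⟨a, a * FreeGroup.of i, rfl, rfl, ?_⟩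
  rw [inv_mul_cancel_left]
  rfl

lemma qdist_spec (n : ℕ) (x y : F2 ⧸ Gamma n) :
    ∃ g : F2, y = x * QuotientGroup.mk g ∧ wordLen g = qdist n x y := by
  have hne : {k : ℕ | ∃ a b : F2, QuotientGroup.mk a = x ∧ QuotientGroup.mk b = y ∧
      wordLen (a⁻¹ * b) = k}.Nonempty := by
    obtain ⟨a, rfl⟩ := QuotientGroup.mk_surjective x
    obtain ⟨b, rfl⟩ := QuotientGroup.mk_surjective y
    exact ⟨_, a, b, rfl, rfl, rfl⟩
  obtain ⟨a, b, ha, hb, hab⟩ := Nat.sInf_mem hne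
  refine ⟨a⁻¹ * b, ?_, hab⟩
  rw [← ha, ← hb, ← QuotientGroup.mk_mul, mul_inv_cancel_left]

/-- The box space `(X, d_X) = ⊔ X_n` of `F₂` associated with the iterated square
subgroups `Γ_n` does not have Property A. -/
theorem boxSpace_not_propertyA :
    ¬ HasPropertyA (fun p q : BoxSpace => (boxDist p q : ℝ)) := by
  intro h
  obtain ⟨A, S, hS, hne, hd, hb⟩ := h (1 / 4) (by norm_num) 1 one_pos
  let T := ⌊S⌋₊
  let n := 2 * T + 2
  let _ : DecidableEq (BoxSpace × ℕ) := Classical.decEq _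
  refine core (n := n) (T := T) le_rfl (fun x => A ⟨n, x⟩) (fun x => hne _) ?_ ?_
  · intro x i
    have h1 := hd ⟨n, x⟩ ⟨n, x * QuotientGroup.mk (FreeGroup.of i)⟩ (by
      change ((boxDist ⟨n, x⟩ ⟨n, x * QuotientGroup.mk (FreeGroup.of i)⟩ : ℕ) : ℝ) ≤ 1
      rw [boxDist_same]
      exact_mod_cast qdist_gen n x i)
    refine h1.le.trans ?_
    have h2 : ((A ⟨n, x⟩ ∩ A ⟨n, x * QuotientGroup.mk (FreeGroup.of i)⟩).card : ℝ)
        ≤ (A ⟨n, x⟩).card := by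
      exact_mod_cast Finset.card_le_card Finset.inter_subset_left
    exact mul_le_mul_of_nonneg_left h2 (by norm_num)
  · intro x p hp
    have h1 := hb ⟨n, x⟩ p hp
    have h2 : boxDist ⟨n, x⟩ p.1 ≤ T := Nat.le_floor h1
    obtain ⟨⟨m, y⟩, k⟩ := p
    by_cases hm : n = m
    · subst hm
      rw [boxDist_same] at h2
      obtain ⟨g, hg, hg'⟩ := qdist_spec n x y
      exact ⟨g, by rw [hg], by omega⟩
    · exfalso
      have h3 : boxDist ⟨n, x⟩ ⟨m, y⟩ = qdiam n + qdiam m + n + m := dif_neg hm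
      rw [h3] at h2
      omega
end
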